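/- arXiv:math-ph/0309050 — 8 statements merged into one kernel-verified Lean document; each statement's English description precedes it below -/
import Mathlib

section
/- Let x : (0,1] → ℝ³ be a continuous map with ‖x(ℏ)‖ ≤ 1 for all ℏ, and define A_ℏ^± = (1/2)(I ± x(ℏ)·σ). Then the family {(A_ℏ⁺, A_ℏ⁻)} is asymptotically projective, i.e., ‖(A_ℏ⁺)² − A_ℏ⁺‖ → 0, ‖(A_ℏ⁻)² − A_ℏ⁻‖ → 0, and ‖A_ℏ⁺ A_ℏ⁻‖ → 0 as ℏ → 0 (in operator norm), if and only if lim_{ℏ→0} ‖x(ℏ)‖ = 1. Consequently, spin asymptotic spectral measures correspond bijectively to continuous paths in the closed unit ball B³ ⊂ ℝ³ whose norms tend to 1 as ℏ → 0. -/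
open Matrix
open scoped ComplexOrder

/-- The first Pauli matrix `σ₁ = [[0,1],[1,0]]`. -/
noncomputable def pauli1 : Matrix (Fin 2) (Fin 2) ℂ := !![0, 1; 1, 0]

/-- The second Pauli matrix `σ₂ = [[0,-i],[i,0]]`. -/
noncomputable def pauli2 : Matrix (Fin 2) (Fin 2) ℂ := !![0, -Complex.I; Complex.I, 0]

/-- The third Pauli matrix `σ₃ = [[1,0],[0,-1]]`. -/
noncomputable def pauli3 : Matrix (Fin 2) (Fin 2) ℂ := !![1, 0; 0, -1]

/-- `x · σ = x₁σ₁ + x₂σ₂ + x₃σ₃` for `x ∈ ℝ³`. -/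
noncomputable def dotSigma (x : EuclideanSpace ℝ (Fin 3)) : Matrix (Fin 2) (Fin 2) ℂ :=
  (x 0 : ℂ) • pauli1 + (x 1 : ℂ) • pauli2 + (x 2 : ℂ) • pauli3

/-- The operator norm of a `2×2` complex matrix, viewed as a linear operator on `ℂ²`
with the standard Hermitian inner product. -/
noncomputable def opNorm (M : Matrix (Fin 2) (Fin 2) ℂ) : ℝ :=
  ‖Matrix.toEuclideanCLM (𝕜 := ℂ) M‖

/-- The filter describing the limit `ℏ → 0` for families parameterized by `ℏ ∈ (0,1]`. -/
noncomputable def hbarLimit : Filter (Set.Ioc (0 : ℝ) 1) :=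
  Filter.comap Subtype.val (nhdsWithin 0 (Set.Ioi 0))

/-- `A_ℏ⁺ = ½(I + x(ℏ)·σ)`. -/
noncomputable def Aplus (x : Set.Ioc (0 : ℝ) 1 → EuclideanSpace ℝ (Fin 3))
    (ℏ : Set.Ioc (0 : ℝ) 1) : Matrix (Fin 2) (Fin 2) ℂ :=
  (1 / 2 : ℂ) • ((1 : Matrix (Fin 2) (Fin 2) ℂ) + dotSigma (x ℏ))

/-- `A_ℏ⁻ = ½(I − x(ℏ)·σ)`. -/
noncomputable def Aminus (x : Set.Ioc (0 : ℝ) 1 → EuclideanSpace ℝ (Fin 3))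
    (ℏ : Set.Ioc (0 : ℝ) 1) : Matrix (Fin 2) (Fin 2) ℂ :=
  (1 / 2 : ℂ) • ((1 : Matrix (Fin 2) (Fin 2) ℂ) - dotSigma (x ℏ))

lemma sa_sq (x : EuclideanSpace ℝ (Fin 3)) :
    dotSigma x * dotSigma x = ((‖x‖ ^ 2 : ℝ) : ℂ) • (1 : Matrix (Fin 2) (Fin 2) ℂ) := by
  have h : ‖x‖ ^ 2 = x 0 ^ 2 + x 1 ^ 2 + x 2 ^ 2 := by
    rw [EuclideanSpace.real_norm_sq_eq, Fin.sum_univ_three]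
  rw [h]
  ext i j
  fin_cases i <;> fin_cases j <;>
    simp [dotSigma, pauli1, pauli2, pauli3, Matrix.mul_apply, Fin.sum_univ_two] <;>
    ring_nf <;> simp <;> ring

lemma sa_opNorm (c : ℂ) : opNorm (c • (1 : Matrix (Fin 2) (Fin 2) ℂ)) = ‖c‖ := by
  unfold opNorm
  rw [map_smul, map_one, norm_smul, norm_one, mul_one]

lemma sa_pp (x : Set.Ioc (0 : ℝ) 1 → EuclideanSpace ℝ (Fin 3)) (t : Set.Ioc (0 : ℝ) 1) :
    Aplus x t * Aplus x t - Aplus x t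
      = (((‖x t‖ ^ 2 - 1) / 4 : ℝ) : ℂ) • (1 : Matrix (Fin 2) (Fin 2) ℂ) := by
  have h := sa_sq (x t)
  unfold Aplus
  simp only [smul_mul_smul_comm, add_mul, mul_add, h, one_mul, mul_one]
  push_cast
  module

lemma sa_mm (x : Set.Ioc (0 : ℝ) 1 → EuclideanSpace ℝ (Fin 3)) (t : Set.Ioc (0 : ℝ) 1) :
    Aminus x t * Aminus x t - Aminus x t
      = (((‖x t‖ ^ 2 - 1) / 4 : ℝ) : ℂ) • (1 : Matrix (Fin 2) (Fin 2) ℂ) := by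
  have h := sa_sq (x t)
  unfold Aminus
  simp only [smul_mul_smul_comm, sub_mul, mul_sub, h, one_mul, mul_one]
  push_cast
  module

lemma sa_pm (x : Set.Ioc (0 : ℝ) 1 → EuclideanSpace ℝ (Fin 3)) (t : Set.Ioc (0 : ℝ) 1) :
    Aplus x t * Aminus x t
      = (((1 - ‖x t‖ ^ 2) / 4 : ℝ) : ℂ) • (1 : Matrix (Fin 2) (Fin 2) ℂ) := by
  have h := sa_sq (x t)
  unfold Aminus Aplus
  simp only [smul_mul_smul_comm, add_mul, mul_sub, h, one_mul, mul_one]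
  push_cast
  module

lemma sa_tendsto (x : Set.Ioc (0 : ℝ) 1 → EuclideanSpace ℝ (Fin 3)) :
    (Filter.Tendsto (fun ℏ => opNorm (Aplus x ℏ * Aplus x ℏ - Aplus x ℏ)) hbarLimit (nhds 0) ∧
        Filter.Tendsto (fun ℏ => opNorm (Aminus x ℏ * Aminus x ℏ - Aminus x ℏ)) hbarLimit (nhds 0) ∧
        Filter.Tendsto (fun ℏ => opNorm (Aplus x ℏ * Aminus x ℏ)) hbarLimit (nhds 0)) ↔
        Filter.Tendsto (fun ℏ => ‖x ℏ‖) hbarLimit (nhds 1) := by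
  simp only [sa_pp, sa_mm, sa_pm, sa_opNorm, Complex.norm_real, ← tendsto_zero_iff_norm_tendsto_zero]
  constructor
  · rintro ⟨h, -, -⟩
    have h2 := ((h.mul_const 4).add_const 1).sqrt
    simpa [Real.sqrt_sq] using h2
  · intro h
    have h1 : Filter.Tendsto (fun ℏ => (‖x ℏ‖ ^ 2 - 1) / 4) hbarLimit (nhds 0) := by
      simpa using ((h.pow 2).sub_const 1).div_const 4
    refine ⟨h1, h1, ?_⟩
    simpa using ((h.pow 2).const_sub 1).div_const 4

lemma sa_herm (x : EuclideanSpace ℝ (Fin 3)) : (dotSigma x)ᴴ = dotSigma x := by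
  ext i j
  fin_cases i <;> fin_cases j <;>
    simp [dotSigma, pauli1, pauli2, pauli3, Matrix.conjTranspose_apply]

lemma sa_psd (A : Matrix (Fin 2) (Fin 2) ℂ) (r : ℝ) (hr : r ≤ 1) (hA : Aᴴ = A)
    (h : A * A - A = (((r - 1) / 4 : ℝ) : ℂ) • (1 : Matrix (Fin 2) (Fin 2) ℂ)) :
    A.PosSemidef := by
  have e : A = Aᴴ * A + (((1 - r) / 4 : ℝ) : ℂ) • (1 : Matrix (Fin 2) (Fin 2) ℂ) := by
    rw [hA, sub_eq_iff_eq_add.1 h]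
    push_cast
    module
  rw [e]
  refine (Matrix.posSemidef_conjTranspose_mul_self A).add (Matrix.PosSemidef.one.smul ?_)
  exact Complex.zero_le_real.2 (by linarith)

lemma sa_cont : Continuous dotSigma := by
  unfold dotSigma
  fun_prop

lemma sa_inj {x y : EuclideanSpace ℝ (Fin 3)} (h : dotSigma x = dotSigma y) : x = y := by
  have h00 := congrFun (congrFun h 0) 0
  have h01 := congrFun (congrFun h 0) 1
  simp [dotSigma, pauli1, pauli2, pauli3] at h00 h01
  have hr := congrArg Complex.re h01
  have hi := congrArg Complex.im h01
  simp at hr hi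
  ext i
  fin_cases i <;> simp [*]

/-- The Bloch vector of a matrix. -/
noncomputable def saVec (A : Matrix (Fin 2) (Fin 2) ℂ) : EuclideanSpace ℝ (Fin 3) :=
  WithLp.toLp 2 ![2 * (A 0 1).re, -2 * (A 0 1).im, 2 * (A 0 0).re - 1]

lemma saVec_cont : Continuous saVec := by
  unfold saVec
  refine (PiLp.continuous_toLp 2 _).comp ?_
  refine continuous_pi fun i => ?_
  fin_cases i <;> simp <;> fun_prop

lemma saVec_dot (A : Matrix (Fin 2) (Fin 2) ℂ) (hA : A.PosSemidef) (ht : A.trace = 1) :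
    (1 / 2 : ℂ) • ((1 : Matrix (Fin 2) (Fin 2) ℂ) + dotSigma (saVec A)) = A := by
  have h00 := hA.1.apply 0 0
  have h10 := hA.1.apply 1 0
  rw [Matrix.trace_fin_two] at ht
  have e11 : A 1 1 = 1 - A 0 0 := by rw [← ht]; ring
  have i00 : (A 0 0).im = 0 := Complex.conj_eq_iff_im.1 h00
  ext i j
  fin_cases i <;> fin_cases j <;>
    simp [dotSigma, pauli1, pauli2, pauli3, saVec, e11, ← h10] <;>
    apply Complex.ext <;> simp [i00] <;> ring

lemma saVec_norm (A : Matrix (Fin 2) (Fin 2) ℂ) (hA : A.PosSemidef) (ht : A.trace = 1) :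
    ‖saVec A‖ ≤ 1 := by
  have h00 := hA.1.apply 0 0
  have h10 := hA.1.apply 1 0
  have hd := hA.det_nonneg
  rw [Matrix.trace_fin_two] at ht
  have e11 : A 1 1 = 1 - A 0 0 := by rw [← ht]; ring
  have i00 : (A 0 0).im = 0 := Complex.conj_eq_iff_im.1 h00
  rw [Matrix.det_fin_two, e11, ← h10] at hd
  have hd := (Complex.le_def.1 hd).1
  simp [i00] at hd
  have h : ‖saVec A‖ ^ 2 ≤ 1 := by
    rw [EuclideanSpace.real_norm_sq_eq, Fin.sum_univ_three]
    simp [saVec]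
    nlinarith
  nlinarith [norm_nonneg (saVec A)]

/-- For a continuous path `x : (0,1] → B³` the induced family `A_ℏ^± = ½(I ± x(ℏ)·σ)` is
asymptotically projective iff `‖x(ℏ)‖ → 1` as `ℏ → 0`.  Consequently, the map
`x ↦ {(A_ℏ⁺, A_ℏ⁻)}` is a bijection from continuous paths in the closed unit ball
whose norm tends to `1` onto the set of spin asymptotic spectral measures. -/
theorem spin_asymptotic_spectral_measures :
    (∀ x : Set.Ioc (0 : ℝ) 1 → EuclideanSpace ℝ (Fin 3), Continuous x →
      (∀ ℏ, ‖x ℏ‖ ≤ 1) →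
      ((Filter.Tendsto (fun ℏ => opNorm (Aplus x ℏ * Aplus x ℏ - Aplus x ℏ)) hbarLimit (nhds 0) ∧
        Filter.Tendsto (fun ℏ => opNorm (Aminus x ℏ * Aminus x ℏ - Aminus x ℏ)) hbarLimit (nhds 0) ∧
        Filter.Tendsto (fun ℏ => opNorm (Aplus x ℏ * Aminus x ℏ)) hbarLimit (nhds 0)) ↔
        Filter.Tendsto (fun ℏ => ‖x ℏ‖) hbarLimit (nhds 1))) ∧
    Set.BijOn
      (fun (x : Set.Ioc (0 : ℝ) 1 → EuclideanSpace ℝ (Fin 3)) ℏ => (Aplus x ℏ, Aminus x ℏ))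
      {x | Continuous x ∧ (∀ ℏ, ‖x ℏ‖ ≤ 1) ∧
        Filter.Tendsto (fun ℏ => ‖x ℏ‖) hbarLimit (nhds 1)}
      {A : Set.Ioc (0 : ℝ) 1 → Matrix (Fin 2) (Fin 2) ℂ × Matrix (Fin 2) (Fin 2) ℂ |
        Continuous A ∧
        (∀ ℏ, (A ℏ).1.PosSemidef ∧ (A ℏ).2.PosSemidef ∧
          (A ℏ).1.trace = 1 ∧ (A ℏ).2.trace = 1 ∧ (A ℏ).1 + (A ℏ).2 = 1) ∧
        Filter.Tendsto (fun ℏ => opNorm ((A ℏ).1 * (A ℏ).1 - (A ℏ).1)) hbarLimit (nhds 0) ∧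
        Filter.Tendsto (fun ℏ => opNorm ((A ℏ).2 * (A ℏ).2 - (A ℏ).2)) hbarLimit (nhds 0) ∧
        Filter.Tendsto (fun ℏ => opNorm ((A ℏ).1 * (A ℏ).2)) hbarLimit (nhds 0)} := by
  refine ⟨fun x _ _ => sa_tendsto x, ?_, ?_, ?_⟩
  · rintro x ⟨hc, hn, ht⟩
    refine ⟨?_, ?_, (sa_tendsto x).2 ht⟩
    · have := sa_cont.comp hc
      exact ((continuous_const.add this).const_smul (1 / 2 : ℂ)).prodMk
        ((continuous_const.sub this).const_smul (1 / 2 : ℂ))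
    · intro t
      have hr : ‖x t‖ ^ 2 ≤ 1 := pow_le_one₀ (norm_nonneg _) (hn t)
      refine ⟨sa_psd _ _ hr ?_ (sa_pp x t), sa_psd _ _ hr ?_ (sa_mm x t), ?_, ?_, ?_⟩
      · simp [Aplus, sa_herm]
      · simp [Aminus, sa_herm]
      · simp [Aplus, Matrix.trace_fin_two, dotSigma, pauli1, pauli2, pauli3]
      · simp [Aminus, Matrix.trace_fin_two, dotSigma, pauli1, pauli2, pauli3]
      · simp only [Aplus, Aminus]
        module
  · intro x _ y _ h
    funext t
    have h1 : Aplus x t = Aplus y t := congrArg Prod.fst (congrFun h t)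
    unfold Aplus at h1
    exact sa_inj (add_left_cancel (smul_right_injective _ (by norm_num : (1 / 2 : ℂ) ≠ 0) h1))
  · rintro A ⟨hc, hA, ht⟩
    have hp : ∀ t, Aplus (fun s => saVec (A s).1) t = (A t).1 := fun t =>
      saVec_dot _ (hA t).1 (hA t).2.2.1
    have hm : ∀ t, Aminus (fun s => saVec (A s).1) t = (A t).2 := fun t => by
      rw [eq_sub_of_add_eq' (hA t).2.2.2.2, ← hp t]
      simp only [Aplus, Aminus]
      module
    refine ⟨fun s => saVec (A s).1, ⟨saVec_cont.comp (continuous_fst.comp hc),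
      fun t => saVec_norm _ (hA t).1 (hA t).2.2.1, ?_⟩, ?_⟩
    · rw [← sa_tendsto]
      simpa only [hp, hm] using ht
    · funext t
      exact Prod.ext (hp t) (hm t)
end

section
/- Let (X, Σ) be a measurable space, H a complex Hilbert space, and A : Σ → B(H) a POVM. For every bounded measurable function f : X → ℂ there exists a unique bounded operator Q(f) ∈ B(H) such that ⟨φ, Q(f)φ⟩ = ∫_X f dμ_φ for all φ ∈ H, where μ_φ is the finite measure μ_φ(Δ) = ⟨φ, A(Δ)φ⟩. Moreover, the map f ↦ Q(f) is linear, and positive: if f ≥ 0 pointwise then Q(f) is a positive operator. -/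
open MeasureTheory
open scoped ComplexInnerProductSpace ComplexOrder

theorem povm_aux_bound {H : Type*} [NormedAddCommGroup H] [InnerProductSpace ℂ H]
    (T : H →L[ℂ] H) (w : ℝ) (hw : 0 ≤ w) (h : ∀ φ, ‖⟪φ, T φ⟫‖ ≤ w * ‖φ‖ ^ 2) :
    ‖T‖ ≤ 2 * w := by
  have h' : ∀ φ, ‖⟪T φ, φ⟫‖ ≤ w * ‖φ‖ ^ 2 := fun φ => by
    rw [norm_inner_symm]; exact h φ
  have key : ∀ x y : H, ‖⟪T y, x⟫‖ ≤ w * (‖x‖ ^ 2 + ‖y‖ ^ 2) := by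
    intro x y
    have e := inner_map_polarization (T : H →ₗ[ℂ] H) x y
    simp only [ContinuousLinearMap.coe_coe] at e
    rw [e, norm_div]
    have p1 := parallelogram_law_with_norm ℂ x y
    have p2 := parallelogram_law_with_norm ℂ x (Complex.I • y)
    have n1 : ‖Complex.I • y‖ = ‖y‖ := by simp [norm_smul]
    rw [n1] at p2
    have a1 := h' (x + y)
    have a2 := h' (x - y)
    have a3 := h' (x + Complex.I • y)
    have a4 := h' (x - Complex.I • y)
    have four : ‖(4 : ℂ)‖ = 4 := by simp
    rw [four, div_le_iff₀ (by norm_num)]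
    refine (norm_sub_le _ _).trans ?_
    refine (add_le_add_left (norm_add_le _ _) _).trans ?_
    refine (add_le_add_left (add_le_add_left (norm_sub_le _ _) _) _).trans ?_
    simp only [norm_mul, Complex.norm_I, one_mul]
    nlinarith
  refine T.opNorm_le_bound (by positivity) fun y => ?_
  by_cases hT : T y = 0
  · rw [hT, norm_zero]; positivity
  have hy : y ≠ 0 := by rintro rfl; simp at hT
  have hy0 : 0 < ‖y‖ := norm_pos_iff.2 hy
  have hT0 : 0 < ‖T y‖ := norm_pos_iff.2 hT
  have k := key (((‖y‖ / ‖T y‖ : ℝ) : ℂ) • T y) y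
  have e1 : ‖((‖y‖ / ‖T y‖ : ℝ) : ℂ) • T y‖ = ‖y‖ := by
    rw [norm_smul, Complex.norm_real, Real.norm_of_nonneg (by positivity)]
    field_simp
  rw [e1, inner_smul_right, inner_self_eq_norm_sq_to_K, norm_mul, Complex.norm_real,
    Real.norm_of_nonneg (by positivity), norm_pow] at k
  have e2 : ‖((‖T y‖ : ℝ) : ℂ)‖ = ‖T y‖ := by simp
  have k2 : ‖y‖ / ‖T y‖ * ‖T y‖ ^ 2 ≤ w * (‖y‖ ^ 2 + ‖y‖ ^ 2) := by
    simpa using k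
  have e3 : ‖y‖ / ‖T y‖ * ‖T y‖ ^ 2 = ‖y‖ * ‖T y‖ := by field_simp
  rw [e3] at k2
  nlinarith

theorem povm_aux_simple {X : Type*} [MeasurableSpace X] (f : X → ℂ) (hf : Measurable f)
    (C : ℝ) (hC : ∀ x, ‖f x‖ ≤ C) (d : ℝ) (hd : 0 < d) :
    ∃ g : SimpleFunc X ℂ, ∀ x, ‖f x - g x‖ ≤ 2 * d := by
  let F : ℤ × ℤ → ℂ := fun p => ((d * p.1 : ℝ) : ℂ) + ((d * p.2 : ℝ) : ℂ) * Complex.I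
  let G : X → ℤ × ℤ := fun x => (⌊(f x).re / d⌋, ⌊(f x).im / d⌋)
  have hG : Measurable G := by
    refine Measurable.prodMk ?_ ?_
    · exact Int.measurable_floor.comp ((Complex.measurable_re.comp hf).div_const d)
    · exact Int.measurable_floor.comp ((Complex.measurable_im.comp hf).div_const d)
  have hfinG : (Set.range G).Finite := by
    refine ((Set.finite_Icc ⌊-C / d⌋ ⌊C / d⌋).prod (Set.finite_Icc ⌊-C / d⌋ ⌊C / d⌋)).subset ?_
    rintro _ ⟨x, rfl⟩
    have h1 := abs_le.1 ((Complex.abs_re_le_norm (f x)).trans (hC x))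
    have h2 := abs_le.1 ((Complex.abs_im_le_norm (f x)).trans (hC x))
    refine ⟨⟨?_, ?_⟩, ⟨?_, ?_⟩⟩ <;> apply Int.floor_le_floor <;>
      apply div_le_div_of_nonneg_right _ hd.le
    exacts [h1.1, h1.2, h2.1, h2.2]
  let g : SimpleFunc X (ℤ × ℤ) := ⟨G, fun p => hG (measurableSet_singleton p), hfinG⟩
  refine ⟨g.map F, fun x => ?_⟩
  have fl : ∀ r : ℝ, |r - d * ⌊r / d⌋| ≤ d := by
    intro r
    have h1 := Int.floor_le (r / d)
    have h2 := Int.lt_floor_add_one (r / d)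
    rw [le_div_iff₀ hd] at h1
    rw [div_lt_iff₀ hd] at h2
    rw [abs_le]; constructor <;> nlinarith
  have e : (g.map F) x = F (G x) := rfl
  rw [e]
  refine (Complex.norm_le_abs_re_add_abs_im _).trans ?_
  have h1 := fl (f x).re
  have h2 := fl (f x).im
  have e1 : (f x - F (G x)).re = (f x).re - d * ⌊(f x).re / d⌋ := by simp [F, G]
  have e2 : (f x - F (G x)).im = (f x).im - d * ⌊(f x).im / d⌋ := by simp [F, G]
  rw [e1, e2]; linarith

theorem povm_aux_integrable {X : Type*} [MeasurableSpace X] (ν : Measure X) [IsFiniteMeasure ν]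
    (f : X → ℂ) (hf : Measurable f) (hb : ∃ C : ℝ, ∀ x, ‖f x‖ ≤ C) : Integrable f ν := by
  obtain ⟨C, hC⟩ := hb
  exact Integrable.of_bound hf.aestronglyMeasurable C (Filter.Eventually.of_forall hC)

theorem povm_aux_exists
    {X : Type*} [MeasurableSpace X]
    {H : Type*} [NormedAddCommGroup H] [InnerProductSpace ℂ H] [CompleteSpace H]
    (A : Set X → H →L[ℂ] H) (μ : H → Measure X)
    (hfin : ∀ φ : H, IsFiniteMeasure (μ φ))
    (hcompat : ∀ (φ : H) (Δ : Set X), MeasurableSet Δ →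
      ((μ φ Δ).toReal : ℂ) = ⟪φ, A Δ φ⟫)
    (f : X → ℂ) (hf : Measurable f) (hb : ∃ C : ℝ, ∀ x, ‖f x‖ ≤ C) :
    ∃ T : H →L[ℂ] H, ∀ φ : H, ⟪φ, T φ⟫ = ∫ x, f x ∂(μ φ) := by
  have hmass : ∀ φ, (μ φ).real Set.univ ≤ ‖A Set.univ‖ * ‖φ‖ ^ 2 := by
    intro φ
    have h := congrArg norm (hcompat φ Set.univ MeasurableSet.univ)
    rw [Complex.norm_real, Real.norm_of_nonneg ENNReal.toReal_nonneg] at h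
    change (μ φ Set.univ).toReal ≤ _
    rw [h]
    refine (norm_inner_le_norm _ _).trans ?_
    have := (A Set.univ).le_opNorm φ
    nlinarith [norm_nonneg φ]
  have hsimple : ∀ g : SimpleFunc X ℂ, ∃ T : H →L[ℂ] H,
      ∀ φ : H, ⟪φ, T φ⟫ = ∫ x, g x ∂(μ φ) := by
    intro g
    refine ⟨∑ c ∈ g.range, c • A (g ⁻¹' {c}), fun φ => ?_⟩
    have hi : Integrable g (μ φ) := SimpleFunc.integrable_of_isFiniteMeasure g
    rw [← SimpleFunc.integral_eq_integral g hi, SimpleFunc.integral_eq,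
      ContinuousLinearMap.sum_apply, inner_sum]
    refine Finset.sum_congr rfl fun c _ => ?_
    rw [ContinuousLinearMap.smul_apply, inner_smul_right,
      ← hcompat φ _ (g.measurableSet_fiber c), Complex.real_smul, mul_comm]
    rfl
  obtain ⟨C, hC⟩ := hb
  have hg : ∀ n : ℕ, ∃ g : SimpleFunc X ℂ, ∀ x, ‖f x - g x‖ ≤ 2 * (1 / ((n : ℝ) + 1)) :=
    fun n => povm_aux_simple f hf C hC _ (by positivity)
  choose g hg using hg
  choose T hT using fun n => hsimple (g n)
  have hlim : Filter.Tendsto (fun n : ℕ => 1 / ((n : ℝ) + 1)) Filter.atTop (nhds 0) :=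
    tendsto_one_div_add_atTop_nhds_zero_nat
  have hmono : ∀ N n : ℕ, N ≤ n → 1 / ((n : ℝ) + 1) ≤ 1 / ((N : ℝ) + 1) := by
    intro N n h
    exact Nat.one_div_le_one_div h
  have hcau : CauchySeq T := by
    refine cauchySeq_of_le_tendsto_0
      (fun N : ℕ => 2 * (4 * (1 / ((N : ℝ) + 1)) * ‖A Set.univ‖)) ?_ ?_
    · intro n m N hn hm
      rw [dist_eq_norm]
      refine povm_aux_bound _ _ (by positivity) fun φ => ?_
      haveI := hfin φ
      rw [ContinuousLinearMap.sub_apply, inner_sub_right, hT, hT,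
        ← integral_sub (SimpleFunc.integrable_of_isFiniteMeasure (g n)) (SimpleFunc.integrable_of_isFiniteMeasure (g m))]
      refine (norm_integral_le_of_norm_le_const (C := 4 * (1 / ((N : ℝ) + 1)))
        (Filter.Eventually.of_forall fun x => ?_)).trans ?_
      · have h1 := hg n x
        have h2 := hg m x
        have h3 := hmono N n hn
        have h4 := hmono N m hm
        have e : g n x - g m x = (f x - g m x) - (f x - g n x) := by ring
        rw [e]
        refine (norm_sub_le _ _).trans ?_
        linarith
      · have h5 : 0 ≤ 4 * (1 / ((N : ℝ) + 1)) := by positivity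
        exact (mul_le_mul_of_nonneg_left (hmass φ) h5).trans_eq (mul_assoc _ _ _).symm
    · have := ((hlim.const_mul 4).mul_const ‖A Set.univ‖).const_mul 2
      simpa using this
  obtain ⟨S, hS⟩ := cauchySeq_tendsto_of_complete hcau
  refine ⟨S, fun φ => ?_⟩
  haveI := hfin φ
  have l1 : Filter.Tendsto (fun n => ⟪φ, T n φ⟫) Filter.atTop (nhds ⟪φ, S φ⟫) := by
    have : Continuous fun R : H →L[ℂ] H => ⟪φ, R φ⟫ := by fun_prop
    exact (this.tendsto S).comp hS
  refine tendsto_nhds_unique l1 ?_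
  rw [tendsto_iff_norm_sub_tendsto_zero]
  refine squeeze_zero (fun _ => norm_nonneg _) (g := fun n : ℕ =>
    2 * (1 / ((n : ℝ) + 1)) * (μ φ).real Set.univ) (fun n => ?_) ?_
  · rw [hT, ← integral_sub (SimpleFunc.integrable_of_isFiniteMeasure (g n))
      (povm_aux_integrable _ f hf ⟨C, hC⟩)]
    refine norm_integral_le_of_norm_le_const (Filter.Eventually.of_forall fun x => ?_)
    rw [norm_sub_rev]; exact hg n x
  · simpa using (hlim.const_mul 2).mul_const ((μ φ).real Set.univ)

theorem povm_aux_unique {H : Type*} [NormedAddCommGroup H] [InnerProductSpace ℂ H]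
    (S T : H →L[ℂ] H) (h : ∀ φ, ⟪φ, S φ⟫ = ⟪φ, T φ⟫) : S = T := by
  have : (S : H →ₗ[ℂ] H) = T := by
    rw [← ext_inner_map]
    intro φ
    have := congrArg (starRingEnd ℂ) (h φ)
    simp only [inner_conj_symm] at this
    exact this
  exact ContinuousLinearMap.coe_injective this

/-- Integration of bounded measurable functions against a POVM `A` on `(X, Σ)`:
for every bounded measurable `f : X → ℂ` there is a unique bounded operator `Q(f)` with
`⟪φ, Q(f) φ⟫ = ∫ f dμ_φ` for all `φ`, where `μ_φ(Δ) = ⟪φ, A(Δ) φ⟫`.  Moreover `f ↦ Q(f)`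
is linear and positive. -/
theorem povm_integral_exists_unique
    {X : Type*} [MeasurableSpace X]
    {H : Type*} [NormedAddCommGroup H] [InnerProductSpace ℂ H] [CompleteSpace H]
    (A : Set X → H →L[ℂ] H) (μ : H → Measure X)
    (hempty : A ∅ = 0)
    (hpos : ∀ Δ : Set X, MeasurableSet Δ → (A Δ).IsPositive)
    (hfin : ∀ φ : H, IsFiniteMeasure (μ φ))
    (hcompat : ∀ (φ : H) (Δ : Set X), MeasurableSet Δ →
      ((μ φ Δ).toReal : ℂ) = ⟪φ, A Δ φ⟫) :
    (∀ f : X → ℂ, Measurable f → (∃ C : ℝ, ∀ x, ‖f x‖ ≤ C) →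
      ∃! T : H →L[ℂ] H, ∀ φ : H, ⟪φ, T φ⟫ = ∫ x, f x ∂(μ φ)) ∧
    ∃ Q : (X → ℂ) → (H →L[ℂ] H),
      (∀ f : X → ℂ, Measurable f → (∃ C : ℝ, ∀ x, ‖f x‖ ≤ C) →
        ∀ φ : H, ⟪φ, Q f φ⟫ = ∫ x, f x ∂(μ φ)) ∧
      (∀ f g : X → ℂ, Measurable f → (∃ C : ℝ, ∀ x, ‖f x‖ ≤ C) →
        Measurable g → (∃ C : ℝ, ∀ x, ‖g x‖ ≤ C) → Q (f + g) = Q f + Q g) ∧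
      (∀ (c : ℂ) (f : X → ℂ), Measurable f → (∃ C : ℝ, ∀ x, ‖f x‖ ≤ C) →
        Q (c • f) = c • Q f) ∧
      (∀ f : X → ℂ, Measurable f → (∃ C : ℝ, ∀ x, ‖f x‖ ≤ C) →
        (∀ x, 0 ≤ f x) → (Q f).IsPositive) := by
  classical
  have hex := povm_aux_exists A μ hfin hcompat
  refine ⟨fun f hf hb => ?_, ?_⟩
  · obtain ⟨T, hT⟩ := hex f hf hb
    exact ⟨T, hT, fun S hS => povm_aux_unique S T fun φ => (hS φ).trans (hT φ).symm⟩
  let Q : (X → ℂ) → (H →L[ℂ] H) := fun f =>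
    if h : Measurable f ∧ ∃ C : ℝ, ∀ x, ‖f x‖ ≤ C then (hex f h.1 h.2).choose else 0
  have hQ : ∀ f : X → ℂ, Measurable f → (∃ C : ℝ, ∀ x, ‖f x‖ ≤ C) →
        ∀ φ : H, ⟪φ, Q f φ⟫ = ∫ x, f x ∂(μ φ) := by
    intro f hf hb
    have e : Q f = (hex f hf hb).choose := dif_pos ⟨hf, hb⟩
    rw [e]
    exact (hex f hf hb).choose_spec
  refine ⟨Q, hQ, ?_, ?_, ?_⟩
  · intro f g hf hbf hg hbg
    have hb : ∃ C : ℝ, ∀ x, ‖(f + g) x‖ ≤ C := by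
      obtain ⟨C, hC⟩ := hbf
      obtain ⟨D, hD⟩ := hbg
      exact ⟨C + D, fun x => (norm_add_le _ _).trans (add_le_add (hC x) (hD x))⟩
    refine povm_aux_unique _ _ fun φ => ?_
    haveI := hfin φ
    rw [hQ _ (hf.add hg) hb, ContinuousLinearMap.add_apply, inner_add_right, hQ f hf hbf,
      hQ g hg hbg]
    exact integral_add (povm_aux_integrable _ f hf hbf) (povm_aux_integrable _ g hg hbg)
  · intro c f hf hbf
    have hb : ∃ C : ℝ, ∀ x, ‖(c • f) x‖ ≤ C := by
      obtain ⟨C, hC⟩ := hbf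
      refine ⟨‖c‖ * C, fun x => ?_⟩
      rw [Pi.smul_apply, norm_smul]
      exact mul_le_mul_of_nonneg_left (hC x) (norm_nonneg c)
    refine povm_aux_unique _ _ fun φ => ?_
    rw [hQ _ (hf.const_smul c) hb, ContinuousLinearMap.smul_apply, inner_smul_right, hQ f hf hbf]
    exact integral_smul c f
  · intro f hf hb h0
    have hn : ∀ φ, 0 ≤ ⟪φ, Q f φ⟫ := by
      intro φ
      rw [hQ f hf hb φ]
      have e : ∀ x, f x = (((f x).re : ℝ) : ℂ) := fun x =>
        Complex.ext rfl (Complex.nonneg_iff.1 (h0 x)).2.symm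
      rw [integral_congr_ae (Filter.Eventually.of_forall e), integral_complex_ofReal]
      exact Complex.zero_le_real.2 (integral_nonneg fun x => (Complex.nonneg_iff.1 (h0 x)).1)
    rw [ContinuousLinearMap.isPositive_iff_complex]
    intro φ
    have h1 := Complex.nonneg_iff.1 (hn φ)
    have e : ⟪Q f φ, φ⟫ = ⟪φ, Q f φ⟫ := by
      rw [← inner_conj_symm, Complex.conj_eq_iff_im]
      exact h1.2.symm
    rw [e]
    exact ⟨Complex.ext (by simp) (by simpa using h1.2), h1.1⟩
end

section
/- Let (X, Σ) be a measurable space, H a complex Hilbert space, and A : Σ → B(H) a POVM. For every bounded measurable function f : X → ℂ, the integral operator Q(f) = ∫_X f dA satisfies the norm bound ‖Q(f)‖ ≤ 2 ‖f‖_∞ ‖A(X)‖, where ‖f‖_∞ = sup_{x∈X} |f(x)| and ‖·‖ is the operator norm. -/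
open MeasureTheory
open scoped ComplexInnerProductSpace

theorem norm_le_two_mul_of_quadratic_bound
    {H : Type*} [NormedAddCommGroup H] [InnerProductSpace ℂ H]
    (T : H →L[ℂ] H) (C : ℝ) (hC : 0 ≤ C)
    (h : ∀ φ : H, ‖⟪φ, T φ⟫‖ ≤ C * ‖φ‖ ^ 2) : ‖T‖ ≤ 2 * C := by
  have h' : ∀ φ : H, ‖⟪T φ, φ⟫‖ ≤ C * ‖φ‖ ^ 2 := fun φ => by
    rw [norm_inner_symm]; exact h φ
  have key : ∀ x y : H, ‖⟪T y, x⟫‖ ≤ C * (‖x‖ ^ 2 + ‖y‖ ^ 2) := by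
    intro x y
    have hp := inner_map_polarization (T : H →ₗ[ℂ] H) x y
    simp only [ContinuousLinearMap.coe_coe] at hp
    rw [hp]
    have p1 := parallelogram_law_with_norm ℂ x y
    have p2 := parallelogram_law_with_norm ℂ x (Complex.I • y)
    have hI : ‖Complex.I • y‖ = ‖y‖ := by rw [norm_smul]; simp
    rw [hI] at p2
    have a1 := h' (x + y)
    have a2 := h' (x - y)
    have a3 := h' (x + Complex.I • y)
    have a4 := h' (x - Complex.I • y)
    generalize ⟪T (x + y), x + y⟫ = z1 at *
    generalize ⟪T (x - y), x - y⟫ = z2 at *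
    generalize ⟪T (x + Complex.I • y), x + Complex.I • y⟫ = z3 at *
    generalize ⟪T (x - Complex.I • y), x - Complex.I • y⟫ = z4 at *
    have hn : ‖z1 - z2 + Complex.I * z3 - Complex.I * z4‖ ≤ ‖z1‖ + ‖z2‖ + ‖z3‖ + ‖z4‖ := by
      have b1 := norm_sub_le (z1 - z2 + Complex.I * z3) (Complex.I * z4)
      have b2 := norm_add_le (z1 - z2) (Complex.I * z3)
      have b3 := norm_sub_le z1 z2
      simp only [norm_mul, Complex.norm_I, one_mul] at b1 b2
      linarith
    rw [norm_div, Complex.norm_ofNat, div_le_iff₀ (by norm_num)]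
    have e : C * ‖x + y‖ ^ 2 + C * ‖x - y‖ ^ 2 + C * ‖x + Complex.I • y‖ ^ 2
        + C * ‖x - Complex.I • y‖ ^ 2 = C * (‖x‖ ^ 2 + ‖y‖ ^ 2) * 4 := by
      linear_combination C * p1 + C * p2
    linarith
  refine ContinuousLinearMap.opNorm_le_bound _ (by positivity) fun y => ?_
  by_cases hT : T y = 0
  · rw [hT, norm_zero]; positivity
  have hTy : 0 < ‖T y‖ := norm_pos_iff.mpr hT
  have hy : 0 < ‖y‖ := norm_pos_iff.mpr fun h0 => hT (by simp [h0])
  have k := key (((‖y‖ / ‖T y‖ : ℝ) : ℂ) • T y) y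
  rw [inner_smul_right, norm_mul, norm_smul, Complex.norm_real, Real.norm_eq_abs,
    abs_of_pos (by positivity), inner_self_eq_norm_sq_to_K, div_mul_cancel₀ _ hTy.ne'] at k
  simp only [norm_pow, RCLike.norm_ofReal, abs_norm] at k
  have e : ‖y‖ / ‖T y‖ * ‖T y‖ ^ 2 = ‖y‖ * ‖T y‖ := by field_simp
  rw [e] at k
  refine le_of_mul_le_mul_left ?_ hy
  linarith

/-- The integral `Q(f) = ∫_X f dA` of a bounded measurable function against a POVM `A`
satisfies the norm bound `‖Q(f)‖ ≤ 2 ‖f‖_∞ ‖A(X)‖`. -/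
theorem povm_integral_norm_bound
    {X : Type*} [MeasurableSpace X]
    {H : Type*} [NormedAddCommGroup H] [InnerProductSpace ℂ H] [CompleteSpace H]
    (A : Set X → H →L[ℂ] H) (μ : H → Measure X)
    (hempty : A ∅ = 0)
    (hpos : ∀ Δ : Set X, MeasurableSet Δ → (A Δ).IsPositive)
    (hfin : ∀ φ : H, IsFiniteMeasure (μ φ))
    (hcompat : ∀ (φ : H) (Δ : Set X), MeasurableSet Δ →
      ((μ φ Δ).toReal : ℂ) = ⟪φ, A Δ φ⟫)
    (f : X → ℂ) (hf : Measurable f) (hbdd : BddAbove (Set.range fun x => ‖f x‖))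
    (T : H →L[ℂ] H) (hT : ∀ φ : H, ⟪φ, T φ⟫ = ∫ x, f x ∂(μ φ)) :
    ‖T‖ ≤ 2 * (⨆ x, ‖f x‖) * ‖A Set.univ‖ := by
  have hM : 0 ≤ ⨆ x, ‖f x‖ := Real.iSup_nonneg fun x => norm_nonneg _
  rw [mul_assoc]
  refine norm_le_two_mul_of_quadratic_bound T _ (by positivity) fun φ => ?_
  have := hfin φ
  rw [hT]
  have h1 : ‖∫ x, f x ∂(μ φ)‖ ≤ (⨆ x, ‖f x‖) * (μ φ).real Set.univ :=
    norm_integral_le_of_norm_le_const (Filter.Eventually.of_forall fun x => le_ciSup hbdd x)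
  have h2 : (μ φ).real Set.univ ≤ ‖A Set.univ‖ * ‖φ‖ ^ 2 := by
    have h3 := congrArg norm (hcompat φ Set.univ MeasurableSet.univ)
    rw [Complex.norm_real, Real.norm_eq_abs, abs_of_nonneg ENNReal.toReal_nonneg] at h3
    rw [Measure.real, h3]
    have h4 := norm_inner_le_norm (𝕜 := ℂ) φ (A Set.univ φ)
    have h5 := mul_le_mul_of_nonneg_left ((A Set.univ).le_opNorm φ) (norm_nonneg φ)
    linarith
  have h6 := mul_le_mul_of_nonneg_left h2 hM
  linarith
end

section
/- Let X be a second countable locally compact Hausdorff space with Borel σ-algebra Σ_X, and let H be a complex Hilbert space. For every positive linear map Q : C₀(X, ℂ) → B(H) (i.e., Q(f) is a positive operator whenever f ≥ 0) there exists a unique Borel POVM A : Σ_X → B(H) such that ⟨φ, Q(f)φ⟩ = ∫_X f dμ_φ for all φ ∈ H and all f ∈ C₀(X, ℂ), where μ_φ(Δ) = ⟨φ, A(Δ)φ⟩. -/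
open MeasureTheory
open scoped ComplexInnerProductSpace ComplexOrder ZeroAtInfty

namespace POVMRiesz

open scoped NNReal CompactlySupported

section bound

variable {X : Type*} [TopologicalSpace X]
  {H : Type*} [NormedAddCommGroup H] [InnerProductSpace ℂ H] [CompleteSpace H]

/-- Positive maps on `C₀(X, ℂ)` are bounded. -/
lemma exists_bound (Q : C₀(X, ℂ) →ₗ[ℂ] (H →L[ℂ] H))
    (hQpos : ∀ f : C₀(X, ℂ), (∀ x, 0 ≤ f x) → (Q f).IsPositive) :
    ∃ C : ℝ≥0, ∀ f, ‖Q f‖ ≤ C * ‖f‖ := by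
  letI : PartialOrder C₀(X, ℂ) := CStarAlgebra.spectralOrder C₀(X, ℂ)
  haveI : StarOrderedRing C₀(X, ℂ) := CStarAlgebra.spectralOrderedRing C₀(X, ℂ)
  refine PositiveLinearMap.exists_norm_apply_le (PositiveLinearMap.mk₀ Q fun f hf => ?_)
  rw [ContinuousLinearMap.nonneg_iff_isPositive]
  refine hQpos f fun x => ?_
  obtain ⟨s, rfl⟩ := CStarAlgebra.nonneg_iff_eq_star_mul_self.mp hf
  simpa using star_mul_self_nonneg (s x)

end bound

section emb

variable {X : Type*} [TopologicalSpace X]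

/-- The embedding of `C_c(X, ℝ)` into `C₀(X, ℂ)`. -/
noncomputable def emb : C_c(X, ℝ) →ₗ[ℝ] C₀(X, ℂ) where
  toFun f :=
    { toFun := fun x => (f x : ℂ)
      continuous_toFun := by fun_prop
      zero_at_infty' := by
        have := f.hasCompactSupport.is_zero_at_infty
        have h2 := (Complex.continuous_ofReal.tendsto 0).comp this
        rw [Complex.ofReal_zero] at h2
        exact h2 }
  map_add' f g := by ext x; simp
  map_smul' r f := by ext x; simp

@[simp] lemma emb_apply (f : C_c(X, ℝ)) (x : X) : emb f x = (f x : ℂ) := rfl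

variable [SecondCountableTopology X] [LocallyCompactSpace X]
    [T2Space X] [MeasurableSpace X] [BorelSpace X]

lemma ext_measure {μ ν : Measure X} [IsFiniteMeasure μ] [IsFiniteMeasure ν]
    (h : ∀ f : C_c(X, ℝ), ∫ x, f x ∂μ = ∫ x, f x ∂ν) : μ = ν :=
  Measure.ext_of_integral_eq_on_compactlySupported h

lemma integrable_cc (μ : Measure X) [IsFiniteMeasure μ] (f : C_c(X, ℝ)) :
    Integrable (fun x => f x) μ :=
  f.continuous.integrable_of_hasCompactSupport f.hasCompactSupport

lemma comb_zero {ι : Type*} (s : Finset ι) (c : ι → ℝ) (μ : ι → Measure X)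
    [∀ i, IsFiniteMeasure (μ i)]
    (h : ∀ f : C_c(X, ℝ), ∑ i ∈ s, c i * ∫ x, f x ∂(μ i) = 0) (Δ : Set X) :
    ∑ i ∈ s, c i * (μ i).real Δ = 0 := by
  have key : ∀ a : ℝ, (a.toNNReal : ℝ) - ((-a).toNNReal : ℝ) = a := fun a => by
    simp
  have hint : ∀ (d : ι → ℝ≥0) (f : C_c(X, ℝ)),
      ∫ x, f x ∂(∑ i ∈ s, d i • μ i) = ∑ i ∈ s, (d i : ℝ) * ∫ x, f x ∂(μ i) := by
    intro d f
    rw [integral_finset_sum_measure (fun i _ => integrable_cc _ f)]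
    refine Finset.sum_congr rfl fun i _ => ?_
    rw [integral_smul_nnreal_measure]; rfl
  have hreal : ∀ (d : ι → ℝ≥0),
      (∑ i ∈ s, d i • μ i).real Δ = ∑ i ∈ s, (d i : ℝ) * (μ i).real Δ := by
    intro d
    simp only [Measure.real, Measure.finset_sum_apply, Measure.smul_apply]
    rw [ENNReal.toReal_sum]
    · refine Finset.sum_congr rfl fun i _ => ?_
      simp [ENNReal.smul_def]
    · intro i _
      simpa [ENNReal.smul_def] using ENNReal.mul_ne_top ENNReal.coe_ne_top (measure_ne_top (μ i) Δ)
  have heq : ∑ i ∈ s, (c i).toNNReal • μ i = ∑ i ∈ s, (-c i).toNNReal • μ i := by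
    apply ext_measure
    intro f
    rw [hint, hint, ← sub_eq_zero, ← Finset.sum_sub_distrib, ← h f]
    refine Finset.sum_congr rfl fun i _ => ?_
    rw [← sub_mul, key]
  have := congrArg (fun m : Measure X => m.real Δ) heq
  simp only [hreal] at this
  rw [← sub_eq_zero, ← Finset.sum_sub_distrib] at this
  rw [← this]
  refine Finset.sum_congr rfl fun i _ => ?_
  rw [← sub_mul, key]

end emb

section form

variable {H : Type*} [NormedAddCommGroup H] [InnerProductSpace ℂ H]

/-- Formal polarization. -/
noncomputable def pol (x y : H) : H →₀ ℂ :=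
  (1 / 4 : ℂ) • (Finsupp.single (x + y) 1 - Finsupp.single (x - y) 1
    - Finsupp.single (x + Complex.I • y) Complex.I + Finsupp.single (x - Complex.I • y) Complex.I)

noncomputable def ev (q : H → ℂ) : (H →₀ ℂ) →ₗ[ℂ] ℂ := Finsupp.linearCombination ℂ q

lemma ev_single (q : H → ℂ) (v : H) (c : ℂ) : ev q (Finsupp.single v c) = c * q v := by
  simp [ev]

lemma ev_pol (q : H → ℂ) (x y : H) : ev q (pol x y) = (1 / 4 : ℂ) * (q (x + y) - q (x - y)
    - Complex.I * q (x + Complex.I • y) + Complex.I * q (x - Complex.I • y)) := by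
  rw [pol, map_smul, map_add, map_sub, map_sub]
  simp only [ev_single, smul_eq_mul, one_mul]

lemma ev_pol_op (T : H →L[ℂ] H) (x y : H) : ev (fun v => ⟪v, T v⟫) (pol x y) = ⟪x, T y⟫ := by
  rw [ev_pol]
  simp only [map_add, map_sub, map_smul, inner_add_left, inner_add_right, inner_sub_left,
    inner_sub_right, inner_smul_left, inner_smul_right, Complex.conj_I]
  linear_combination (-(1 / 2 : ℂ) * ⟪x, T y⟫ + (1 / 2 : ℂ) * ⟪y, T x⟫) * Complex.I_mul_I

/-- A function annihilated by all universal linear relations between quadratic forms, and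
bounded, comes from an operator. -/
lemma exists_op [CompleteSpace H] (q : H → ℝ) (hq0 : ∀ v, 0 ≤ q v) (C : ℝ) (hC : 0 ≤ C)
    (hqC : ∀ v, q v ≤ C * ‖v‖ ^ 2)
    (hq : ∀ w : H →₀ ℂ, (∀ T : H →L[ℂ] H, ev (fun v => ⟪v, T v⟫) w = 0) →
      ev (fun v => (q v : ℂ)) w = 0) :
    ∃ A : H →L[ℂ] H, A.IsPositive ∧ ∀ v, (q v : ℂ) = ⟪v, A v⟫ := by
  have hq' : ∀ w w' : H →₀ ℂ, (∀ T : H →L[ℂ] H, ev (fun v => ⟪v, T v⟫) w =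
      ev (fun v => ⟪v, T v⟫) w') → ev (fun v => (q v : ℂ)) w = ev (fun v => (q v : ℂ)) w' := by
    intro w w' h
    rw [← sub_eq_zero, ← map_sub]
    exact hq _ fun T => by rw [map_sub, h T, sub_self]
  set B : H → H → ℂ := fun x y => ev (fun v => (q v : ℂ)) (pol x y) with hB
  have hsingle : ∀ v, ev (fun v => (q v : ℂ)) (Finsupp.single v 1) = q v := fun v => by
    rw [ev_single, one_mul]
  have hneg : ∀ v, q (-v) = q v := fun v => by
    have := hq' (Finsupp.single (-v) 1) (Finsupp.single v 1) fun T => by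
      simp [ev_single]
    rw [hsingle, hsingle] at this
    exact_mod_cast this
  have hI : ∀ v, q (Complex.I • v) = q v := fun v => by
    have := hq' (Finsupp.single (Complex.I • v) 1) (Finsupp.single v 1) fun T => by
      simp only [ev_single, map_smul, inner_smul_left, inner_smul_right, Complex.conj_I]
      linear_combination (-⟪v, T v⟫) * Complex.I_mul_I
    rw [hsingle, hsingle] at this
    exact_mod_cast this
  have hdiag : ∀ x, B x x = q x := fun x => by
    rw [← hsingle]
    exact hq' _ _ fun T => by rw [ev_pol_op, ev_single, one_mul]
  have hadd_r : ∀ x y z, B x (y + z) = B x y + B x z := fun x y z => by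
    simp only [hB]; rw [← map_add]
    exact hq' _ _ fun T => by simp only [map_add, ev_pol_op, inner_add_right]
  have hadd_l : ∀ x y z, B (x + y) z = B x z + B y z := fun x y z => by
    simp only [hB]; rw [← map_add]
    exact hq' _ _ fun T => by simp only [map_add, ev_pol_op, inner_add_left]
  have hsmul_r : ∀ (c : ℂ) x y, B x (c • y) = c * B x y := fun c x y => by
    simp only [hB]; rw [← smul_eq_mul, ← map_smul]
    exact hq' _ _ fun T => by simp only [map_smul, ev_pol_op, inner_smul_right, smul_eq_mul]
  have hsmul_l : ∀ (c : ℂ) x y, B (c • x) y = (starRingEnd ℂ) c * B x y := fun c x y => by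
    simp only [hB]; rw [← smul_eq_mul, ← map_smul]
    exact hq' _ _ fun T => by simp only [map_smul, ev_pol_op, inner_smul_left, smul_eq_mul]
  have hconj : ∀ x y, (starRingEnd ℂ) (B y x) = B x y := fun x y => by
    simp only [hB, ev_pol]
    have h1 : q (y + x) = q (x + y) := by rw [add_comm]
    have h2 : q (y - x) = q (x - y) := by rw [← hneg, neg_sub]
    have h3 : q (y + Complex.I • x) = q (x - Complex.I • y) := by
      rw [← hI (x - Complex.I • y), smul_sub, smul_smul, Complex.I_mul_I]
      congr 1; module
    have h4 : q (y - Complex.I • x) = q (x + Complex.I • y) := by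
      rw [← hI (x + Complex.I • y), ← hneg, smul_add, smul_smul, Complex.I_mul_I]
      congr 1; module
    rw [h1, h2, h3, h4]
    simp only [map_mul, map_add, map_sub, Complex.conj_I, Complex.conj_ofReal, map_div₀, map_one,
      map_ofNat]
    ring
  letI core : PreInnerProductSpace.Core ℂ H :=
    { inner := B
      conj_inner_symm := hconj
      re_inner_nonneg := fun x => by
        change 0 ≤ (B x x).re
        rw [hdiag]; exact_mod_cast hq0 x
      add_left := hadd_l
      smul_left := fun x y r => hsmul_l r x y }
  have hCS : ∀ x y, ‖B x y‖ * ‖B y x‖ ≤ (B x x).re * (B y y).re :=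
    fun x y => @InnerProductSpace.Core.inner_mul_inner_self_le ℂ H _ _ _ core x y
  have hbd : ∀ x y, ‖B x y‖ ≤ C * ‖x‖ * ‖y‖ := fun x y => by
    have h := hCS x y
    rw [← hconj y x, RCLike.norm_conj, hdiag, hdiag, Complex.ofReal_re, Complex.ofReal_re] at h
    refine abs_le_of_sq_le_sq' ?_ (by positivity) |>.2
    calc ‖B x y‖ ^ 2 = ‖B x y‖ * ‖B x y‖ := sq _
      _ ≤ q x * q y := h
      _ ≤ (C * ‖x‖ ^ 2) * (C * ‖y‖ ^ 2) := mul_le_mul (hqC x) (hqC y) (hq0 y) (by positivity)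
      _ = _ := by ring
  let Bl : H →ₗ⋆[ℂ] H →ₗ[ℂ] ℂ := LinearMap.mk₂'ₛₗ (starRingEnd ℂ) (RingHom.id ℂ) B hadd_l
    hsmul_l hadd_r hsmul_r
  let Bc : H →L⋆[ℂ] H →L[ℂ] ℂ := Bl.mkContinuous₂ C hbd
  have hA : ∀ v, ⟪InnerProductSpace.continuousLinearMapOfBilin Bc v, v⟫ = (q v : ℂ) := fun v => by
    rw [InnerProductSpace.continuousLinearMapOfBilin_apply, ← hdiag]
    rfl
  refine ⟨InnerProductSpace.continuousLinearMapOfBilin Bc, ?_, fun v => ?_⟩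
  · rw [ContinuousLinearMap.isPositive_iff_complex]
    intro x
    rw [hA]
    exact ⟨by simp, by simpa using hq0 x⟩
  · rw [← inner_conj_symm, hA, Complex.conj_ofReal]

end form

section meas

variable {X : Type*} [TopologicalSpace X] [SecondCountableTopology X] [LocallyCompactSpace X]
    [T2Space X] [MeasurableSpace X] [BorelSpace X]
    {H : Type*} [NormedAddCommGroup H] [InnerProductSpace ℂ H] [CompleteSpace H]

/-- The scalar measure associated with a vector. -/
lemma exists_measure (Q : C₀(X, ℂ) →ₗ[ℂ] (H →L[ℂ] H))
    (hQpos : ∀ f : C₀(X, ℂ), (∀ x, 0 ≤ f x) → (Q f).IsPositive)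
    (C : ℝ≥0) (hC : ∀ f, ‖Q f‖ ≤ C * ‖f‖) (φ : H) :
    ∃ μ : Measure X, IsFiniteMeasure μ ∧ μ.real Set.univ ≤ C * ‖φ‖ ^ 2 ∧
      ∀ f : C₀(X, ℂ), ⟪φ, Q f φ⟫ = ∫ x, f x ∂μ := by
  have hbd : ∀ f : C₀(X, ℂ), ‖⟪φ, Q f φ⟫‖ ≤ C * ‖φ‖ ^ 2 * ‖f‖ := fun f => by
    calc ‖⟪φ, Q f φ⟫‖ ≤ ‖φ‖ * ‖Q f φ‖ := norm_inner_le_norm _ _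
      _ ≤ ‖φ‖ * (‖Q f‖ * ‖φ‖) := by gcongr; exact (Q f).le_opNorm φ
      _ ≤ ‖φ‖ * ((C * ‖f‖) * ‖φ‖) := by gcongr; exact hC f
      _ = _ := by ring
  have hpos : ∀ f : C_c(X, ℝ), 0 ≤ f → 0 ≤ ⟪φ, Q (emb f) φ⟫ := fun f hf =>
    (hQpos (emb f) fun x => by simpa using hf x).inner_nonneg_right φ
  let L : C_c(X, ℝ) →ₗ[ℝ] ℂ :=
    { toFun := fun f => ⟪φ, Q (emb f) φ⟫
      map_add' := fun f g => by simp [inner_add_right]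
      map_smul' := fun r f => by
        have : emb (r • f) = (r : ℂ) • emb f := by ext x; simp
        rw [this, map_smul]
        simp [inner_smul_right] }
  let Λ : C_c(X, ℝ) →ₚ[ℝ] ℝ := PositiveLinearMap.mk₀ (Complex.reLm ∘ₗ L) fun f hf => by
    exact (Complex.nonneg_iff.mp (hpos f hf)).1
  have hΛ : ∀ f, Λ f = (⟪φ, Q (emb f) φ⟫).re := fun f => rfl
  -- the values are real
  have him : ∀ f : C_c(X, ℝ), (⟪φ, Q (emb f) φ⟫).im = 0 := fun f => by
    have h1 := (Complex.nonneg_iff.mp (hpos (f ⊔ 0) le_sup_right)).2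
    have h2 := (Complex.nonneg_iff.mp (hpos ((-f) ⊔ 0) le_sup_right)).2
    have h3 : f = (f ⊔ 0) - ((-f) ⊔ 0) := by
      ext x
      simp only [CompactlySupportedContinuousMap.sub_apply,
        CompactlySupportedContinuousMap.sup_apply, CompactlySupportedContinuousMap.neg_apply,
        CompactlySupportedContinuousMap.zero_apply]
      rcases le_total 0 (f x) with h | h
      · rw [sup_eq_left.mpr h, sup_eq_right.mpr (by linarith)]; ring
      · rw [sup_eq_right.mpr h, sup_eq_left.mpr (by linarith)]; ring
    rw [h3]
    simp only [map_sub, ContinuousLinearMap.sub_apply, inner_sub_right, Complex.sub_im]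
    rw [← h1, ← h2, sub_zero]
  set μ := RealRMK.rieszMeasure Λ with hμ
  have hint : ∀ f : C_c(X, ℝ), ∫ x, f x ∂μ = (⟪φ, Q (emb f) φ⟫).re := fun f => by
    rw [hμ, RealRMK.integral_rieszMeasure, hΛ]
  have huniv : μ Set.univ ≤ ENNReal.ofReal (C * ‖φ‖ ^ 2) := by
    rw [isOpen_univ.measure_eq_iSup_isCompact μ]
    refine iSup₂_le fun K _ => iSup_le fun hK => ?_
    obtain ⟨g, hg1, -, hgc, hg⟩ := exists_continuous_one_zero_of_isCompact hK isClosed_empty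
      (Set.disjoint_empty K)
    let f : C_c(X, ℝ) := ⟨g, hgc⟩
    have hf : ∀ x, f x = g x := fun x => rfl
    refine (RealRMK.rieszMeasure_le_of_eq_one Λ (f := f) (fun x => (hg x).1) hK
      (fun x hx => hg1 hx)).trans (ENNReal.ofReal_le_ofReal ?_)
    rw [hΛ]
    refine (Complex.re_le_norm _).trans ((hbd _).trans ?_)
    have : ‖emb f‖ ≤ 1 := by
      rw [← ZeroAtInftyContinuousMap.norm_toBCF_eq_norm]
      refine (BoundedContinuousFunction.norm_le zero_le_one).2 fun x => ?_
      change ‖((g x : ℝ) : ℂ)‖ ≤ 1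
      rw [Complex.norm_real, Real.norm_of_nonneg (hg x).1]
      exact (hg x).2
    calc C * ‖φ‖ ^ 2 * ‖emb f‖ ≤ C * ‖φ‖ ^ 2 * 1 := by gcongr
      _ = _ := mul_one _
  haveI hfin : IsFiniteMeasure μ := ⟨huniv.trans_lt ENNReal.ofReal_lt_top⟩
  have hreal : μ.real Set.univ ≤ C * ‖φ‖ ^ 2 := by
    rw [Measure.real]
    exact ENNReal.toReal_le_of_le_ofReal (by positivity) huniv
  refine ⟨μ, hfin, hreal, fun f => ?_⟩
  have hembint : ∀ f : C_c(X, ℝ), ⟪φ, Q (emb f) φ⟫ = ∫ x, emb f x ∂μ := fun f => by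
    simp only [emb_apply]
    rw [integral_complex_ofReal, hint]
    exact Complex.ext (by simp) (by simp [him])
  have hintegrable : ∀ f : C₀(X, ℂ), Integrable (fun x => f x) μ := fun f =>
    f.toBCF.integrable μ
  have hib : ∀ f : C₀(X, ℂ), ‖∫ x, f x ∂μ‖ ≤ C * ‖φ‖ ^ 2 * ‖f‖ := fun f => by
    have := norm_integral_le_of_norm_le_const (μ := μ) (f := fun x => f x) (C := ‖f‖)
      (Filter.Eventually.of_forall fun x => f.toBCF.norm_coe_le_norm x)
    calc _ ≤ ‖f‖ * μ.real Set.univ := this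
      _ ≤ ‖f‖ * (C * ‖φ‖ ^ 2) := by gcongr
      _ = _ := mul_comm _ _
  rw [← sub_eq_zero, ← norm_le_zero_iff]
  refine le_of_forall_pos_le_add fun ε hε => ?_
  rw [zero_add]
  set D : ℝ := C * ‖φ‖ ^ 2 with hD
  have hD0 : 0 ≤ D := by positivity
  obtain ⟨δ, hδ, hδε⟩ : ∃ δ : ℝ, 0 < δ ∧ 2 * D * δ ≤ ε := by
    refine ⟨ε / (2 * D + 1), by positivity, ?_⟩
    rw [mul_div_assoc', div_le_iff₀ (by positivity)]
    nlinarith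
  obtain ⟨K, hK, hKf⟩ : ∃ K : Set X, IsCompact K ∧ ∀ x ∉ K, ‖f x‖ ≤ δ := by
    have h := f.zero_at_infty'.eventually (Metric.ball_mem_nhds (0 : ℂ) hδ)
    obtain ⟨K, hK, hsub⟩ := Filter.mem_cocompact.mp h
    refine ⟨K, hK, fun x hx => ?_⟩
    have := hsub hx
    have h2 : dist (f x) 0 < δ := this
    rw [dist_zero_right] at h2
    exact h2.le
  obtain ⟨g, hg1, -, hgc, hg⟩ := exists_continuous_one_zero_of_isCompact hK isClosed_empty
      (Set.disjoint_empty K)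
  let u : C_c(X, ℝ) := ⟨⟨fun x => g x * (f x).re, by fun_prop⟩, hgc.mul_right⟩
  let v : C_c(X, ℝ) := ⟨⟨fun x => g x * (f x).im, by fun_prop⟩, hgc.mul_right⟩
  set h : C₀(X, ℂ) := emb u + Complex.I • emb v with hh
  have hhx : ∀ x, h x = (g x : ℂ) * f x := fun x => by
    change (((g x * (f x).re : ℝ) : ℂ)) + Complex.I * ((g x * (f x).im : ℝ) : ℂ) = _
    conv_rhs => rw [← Complex.re_add_im (f x)]
    push_cast; ring
  have heq : ⟪φ, Q h φ⟫ = ∫ x, h x ∂μ := by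
    have h1 : (fun x => h x) = fun x => emb u x + Complex.I * emb v x := by
      funext x; rfl
    rw [h1, integral_add (hintegrable _) ((hintegrable _).const_mul _), integral_const_mul,
      ← hembint, ← hembint, hh, map_add, map_smul]
    simp [inner_add_right, inner_smul_right]
  have hnorm : ‖f - h‖ ≤ δ := by
    rw [← ZeroAtInftyContinuousMap.norm_toBCF_eq_norm]
    refine (BoundedContinuousFunction.norm_le hδ.le).2 fun x => ?_
    change ‖f x - h x‖ ≤ δ
    rw [hhx]
    by_cases hx : x ∈ K
    · have : g x = 1 := hg1 hx
      simp [this, hδ.le]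
    · have h1 : f x - (g x : ℂ) * f x = ((1 - g x : ℝ) : ℂ) * f x := by push_cast; ring
      rw [h1, norm_mul, Complex.norm_real, Real.norm_of_nonneg (by linarith [(hg x).2])]
      calc (1 - g x) * ‖f x‖ ≤ 1 * ‖f x‖ := by gcongr; linarith [(hg x).1]
        _ ≤ δ := by rw [one_mul]; exact hKf x hx
  have hdec : ⟪φ, Q f φ⟫ - ∫ x, f x ∂μ = ⟪φ, Q (f - h) φ⟫ - ∫ x, (f - h) x ∂μ := by
    have : ∫ x, (f - h) x ∂μ = ∫ x, f x ∂μ - ∫ x, h x ∂μ :=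
      integral_sub (hintegrable f) (hintegrable h)
    rw [this, map_sub, ContinuousLinearMap.sub_apply, inner_sub_right, heq]
    ring
  rw [hdec]
  calc _ ≤ ‖⟪φ, Q (f - h) φ⟫‖ + ‖∫ x, (f - h) x ∂μ‖ := norm_sub_le _ _
    _ ≤ D * ‖f - h‖ + D * ‖f - h‖ := add_le_add (hbd _) (hib _)
    _ ≤ D * δ + D * δ := by gcongr
    _ ≤ ε := by linarith

lemma int_emb {μ : Measure X} (f : C_c(X, ℝ)) : ∫ x, emb f x ∂μ = ((∫ x, f x ∂μ : ℝ) : ℂ) := by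
  simp only [emb_apply]
  exact integral_complex_ofReal

/-- Linear relations between quadratic forms pass to the measures. -/
lemma relation (Q : C₀(X, ℂ) →ₗ[ℂ] (H →L[ℂ] H)) (μ : H → Measure X)
    [∀ φ, IsFiniteMeasure (μ φ)]
    (hμ : ∀ (f : C₀(X, ℂ)) (φ : H), ⟪φ, Q f φ⟫ = ∫ x, f x ∂(μ φ)) (Δ : Set X)
    (w : H →₀ ℂ) (hw : ∀ T : H →L[ℂ] H, ev (fun v => ⟪v, T v⟫) w = 0) :
    ev (fun v => (((μ v).real Δ : ℝ) : ℂ)) w = 0 := by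
  have key : ∀ f : C_c(X, ℝ), ∑ v ∈ w.support, w v * ((∫ x, f x ∂(μ v) : ℝ) : ℂ) = 0 := fun f => by
    have h := hw (Q (emb f))
    rw [ev, Finsupp.linearCombination_apply, Finsupp.sum] at h
    simpa only [hμ, int_emb, smul_eq_mul] using h
  rw [ev, Finsupp.linearCombination_apply, Finsupp.sum]
  simp only [smul_eq_mul]
  apply Complex.ext
  · simp only [Complex.re_sum, Complex.re_mul_ofReal, Complex.zero_re]
    refine comb_zero _ (fun v => (w v).re) μ (fun f => ?_) Δ
    have := congrArg Complex.re (key f)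
    simpa only [Complex.re_sum, Complex.re_mul_ofReal, Complex.zero_re] using this
  · simp only [Complex.im_sum, Complex.im_mul_ofReal, Complex.zero_im]
    refine comb_zero _ (fun v => (w v).im) μ (fun f => ?_) Δ
    have := congrArg Complex.im (key f)
    simpa only [Complex.im_sum, Complex.im_mul_ofReal, Complex.zero_im] using this

end meas

end POVMRiesz

/-- Riesz representation for POVMs: on a second countable locally compact Hausdorff space
`X`, every positive linear map `Q : C₀(X, ℂ) → B(H)` is represented by a unique Borel POVM
`A` (with associated finite Borel measures `μ_φ(Δ) = ⟪φ, A(Δ)φ⟫`) via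
`⟪φ, Q(f)φ⟫ = ∫_X f dμ_φ`.  (The POVM is normalized to vanish on non-measurable sets, and
is recorded together with the family of measures `μ_φ`.) -/
theorem positive_map_riesz_representation
    {X : Type*} [TopologicalSpace X] [SecondCountableTopology X] [LocallyCompactSpace X]
    [T2Space X] [MeasurableSpace X] [BorelSpace X]
    {H : Type*} [NormedAddCommGroup H] [InnerProductSpace ℂ H] [CompleteSpace H]
    (Q : C₀(X, ℂ) →ₗ[ℂ] (H →L[ℂ] H))
    (hQpos : ∀ f : C₀(X, ℂ), (∀ x, 0 ≤ f x) → (Q f).IsPositive) :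
    ∃! Aμ : (Set X → H →L[ℂ] H) × (H → Measure X),
      Aμ.1 ∅ = 0 ∧
      (∀ Δ : Set X, ¬ MeasurableSet Δ → Aμ.1 Δ = 0) ∧
      (∀ Δ : Set X, MeasurableSet Δ → (Aμ.1 Δ).IsPositive) ∧
      (∀ φ : H, IsFiniteMeasure (Aμ.2 φ)) ∧
      (∀ (φ : H) (Δ : Set X), MeasurableSet Δ →
        ((Aμ.2 φ Δ).toReal : ℂ) = ⟪φ, Aμ.1 Δ φ⟫) ∧
      (∀ (f : C₀(X, ℂ)) (φ : H), ⟪φ, Q f φ⟫ = ∫ x, f x ∂(Aμ.2 φ)) := by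
  classical
  obtain ⟨C, hC⟩ := POVMRiesz.exists_bound Q hQpos
  choose μ hfin hmass hμ using POVMRiesz.exists_measure Q hQpos C hC
  have hop : ∀ Δ : Set X, ∃ A : H →L[ℂ] H, A.IsPositive ∧
      ∀ v, (((μ v).real Δ : ℝ) : ℂ) = ⟪v, A v⟫ := fun Δ =>
    POVMRiesz.exists_op (fun v => (μ v).real Δ) (fun v => measureReal_nonneg) C C.2
      (fun v => (measureReal_mono (Set.subset_univ Δ)).trans (hmass v))
      (fun w hw => POVMRiesz.relation Q μ (fun f φ => hμ φ f) Δ w hw)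
  choose A hApos hA using hop
  have hext : ∀ S T : H →L[ℂ] H, (∀ v, ⟪v, S v⟫ = ⟪v, T v⟫) → S = T := fun S T h => by
    apply ContinuousLinearMap.coe_injective
    rw [← ext_inner_map]
    intro v
    have := congrArg (starRingEnd ℂ) (h v)
    simp only [inner_conj_symm] at this
    exact this
  refine ⟨(fun Δ => if MeasurableSet Δ then A Δ else 0, μ), ?_, ?_⟩
  · refine ⟨?_, fun Δ hΔ => ?_, fun Δ hΔ => ?_, hfin, fun φ Δ hΔ => ?_, fun f φ => hμ φ f⟩
    · simp only [MeasurableSet.empty, if_true]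
      refine hext _ _ fun v => ?_
      rw [← hA]
      simp
    · simp [hΔ]
    · simpa [hΔ] using hApos Δ
    · simp only [hΔ, if_true]
      exact hA Δ φ
  · rintro ⟨A', ν⟩ ⟨-, hn, -, hfin', hAν, hν⟩
    simp only at hn hfin' hAν hν
    have hνμ : ν = μ := by
      funext φ
      haveI := hfin' φ
      haveI := hfin φ
      refine POVMRiesz.ext_measure fun f => ?_
      have h1 := hν (POVMRiesz.emb f) φ
      rw [hμ, POVMRiesz.int_emb, POVMRiesz.int_emb] at h1
      exact_mod_cast h1.symm
    subst hνμ
    refine Prod.ext ?_ rfl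
    funext Δ
    by_cases hΔ : MeasurableSet Δ
    · simp only [hΔ, if_true]
      refine hext _ _ fun v => ?_
      rw [← hA, ← hAν v Δ hΔ]
      rfl
    · simp [hΔ, hn Δ hΔ]
end

section
/- Let (X, Σ) be a measurable space, H a complex Hilbert space, and A : Σ → B(H) a POVM which is projection-valued, i.e., A(Δ ∩ Δ') = A(Δ)A(Δ') for all Δ, Δ' ∈ Σ. Then the associated integration map is multiplicative: Q(fg) = Q(f)Q(g) for all bounded measurable functions f, g : X → ℂ, where Q(f) = ∫_X f dA. -/
open MeasureTheory
open scoped ComplexInnerProductSpace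

/-- `T` represents the bounded measurable function `f` on the diagonal. -/
def PvmRep {X : Type*} [MeasurableSpace X]
    {H : Type*} [NormedAddCommGroup H] [InnerProductSpace ℂ H]
    (μ : H → Measure X) (f : X → ℂ) (T : H →L[ℂ] H) : Prop :=
  Measurable f ∧ (∃ C : ℝ, ∀ x, ‖f x‖ ≤ C) ∧ ∀ φ : H, ⟪φ, T φ⟫ = ∫ x, f x ∂(μ φ)

section helpers
variable {X : Type*} [MeasurableSpace X]
    {H : Type*} [NormedAddCommGroup H] [InnerProductSpace ℂ H]
    {μ : H → Measure X}

theorem PvmRep.integrable {f : X → ℂ} {T : H →L[ℂ] H} (hfin : ∀ φ : H, IsFiniteMeasure (μ φ))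
    (h : PvmRep μ f T) (φ : H) : Integrable f (μ φ) := by
  obtain ⟨hm, ⟨C, hC⟩, -⟩ := h
  have := hfin φ
  exact Integrable.of_bound hm.aestronglyMeasurable C (Filter.Eventually.of_forall hC)

theorem PvmRep.add {f g : X → ℂ} {S T : H →L[ℂ] H} (hfin : ∀ φ : H, IsFiniteMeasure (μ φ))
    (h : PvmRep μ f S) (k : PvmRep μ g T) : PvmRep μ (f + g) (S + T) := by
  refine ⟨h.1.add k.1, ?_, fun φ => ?_⟩
  · obtain ⟨C, hC⟩ := h.2.1
    obtain ⟨D, hD⟩ := k.2.1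
    exact ⟨C + D, fun x => (norm_add_le _ _).trans (add_le_add (hC x) (hD x))⟩
  · have := integral_add (h.integrable hfin φ) (k.integrable hfin φ)
    simp only [Pi.add_apply]
    rw [this, ContinuousLinearMap.add_apply, inner_add_right, h.2.2, k.2.2]

theorem PvmRep.smul {f : X → ℂ} {T : H →L[ℂ] H} (c : ℂ)
    (h : PvmRep μ f T) : PvmRep μ (fun x => c * f x) (c • T) := by
  refine ⟨h.1.const_mul c, ?_, fun φ => ?_⟩
  · obtain ⟨C, hC⟩ := h.2.1
    refine ⟨‖c‖ * C, fun x => ?_⟩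
    rw [norm_mul]
    exact mul_le_mul_of_nonneg_left (hC x) (norm_nonneg _)
  · rw [integral_const_mul, ContinuousLinearMap.smul_apply, inner_smul_right, h.2.2]

theorem pvmRep_indicator {A : Set X → H →L[ℂ] H}
    (hcompat : ∀ (φ : H) (Δ : Set X), MeasurableSet Δ →
      ((μ φ Δ).toReal : ℂ) = ⟪φ, A Δ φ⟫) {Δ : Set X} (hΔ : MeasurableSet Δ) :
    PvmRep μ (Δ.indicator (fun _ => (1 : ℂ))) (A Δ) := by
  refine ⟨measurable_const.indicator hΔ, ⟨1, fun x => ?_⟩, fun φ => ?_⟩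
  · by_cases hx : x ∈ Δ <;> simp [hx]
  · rw [integral_indicator hΔ, ← hcompat φ Δ hΔ]
    simp [Measure.real]

/-- diagonal convergence implies weak convergence -/
theorem pvm_weak {F : ℕ → H →L[ℂ] H} {T : H →L[ℂ] H}
    (h : ∀ φ : H, Filter.Tendsto (fun n => ⟪φ, F n φ⟫) Filter.atTop (nhds ⟪φ, T φ⟫)) (ψ φ : H) :
    Filter.Tendsto (fun n => ⟪ψ, F n φ⟫) Filter.atTop (nhds ⟪ψ, T φ⟫) := by
  have h' : ∀ χ : H, Filter.Tendsto (fun n => ⟪(F n : H →ₗ[ℂ] H) χ, χ⟫) Filter.atTop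
      (nhds ⟪(T : H →ₗ[ℂ] H) χ, χ⟫) := by
    intro χ
    have := (Complex.continuous_conj.tendsto _).comp (h χ)
    simpa [Function.comp_def, inner_conj_symm] using this
  have key : Filter.Tendsto (fun n => ⟪(F n : H →ₗ[ℂ] H) φ, ψ⟫) Filter.atTop
      (nhds ⟪(T : H →ₗ[ℂ] H) φ, ψ⟫) := by
    rw [inner_map_polarization,
      funext fun n => inner_map_polarization (F n : H →ₗ[ℂ] H) ψ φ]
    exact ((((h' _).sub (h' _)).add ((h' _).const_mul _)).sub ((h' _).const_mul _)).div_const _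
  have := (Complex.continuous_conj.tendsto _).comp key
  simpa [Function.comp_def, inner_conj_symm] using this

theorem pvm_dct (hfin : ∀ φ : H, IsFiniteMeasure (μ φ)) {F : ℕ → X → ℂ} {f : X → ℂ} {C : ℝ}
    (hF : ∀ n, Measurable (F n)) (hC : ∀ n x, ‖F n x‖ ≤ C)
    (hl : ∀ x, Filter.Tendsto (fun n => F n x) Filter.atTop (nhds (f x))) (φ : H) :
    Filter.Tendsto (fun n => ∫ x, F n x ∂(μ φ)) Filter.atTop (nhds (∫ x, f x ∂(μ φ))) := by
  have := hfin φ
  exact tendsto_integral_of_dominated_convergence (fun _ => C)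
    (fun n => (hF n).aestronglyMeasurable) (integrable_const C)
    (fun n => Filter.Eventually.of_forall (hC n)) (Filter.Eventually.of_forall hl)

theorem pvm_approx {f : X → ℂ} (hf : Measurable f) (hfb : ∃ C : ℝ, ∀ x, ‖f x‖ ≤ C) :
    ∃ (C : ℝ) (s : ℕ → SimpleFunc X ℂ), 0 ≤ C ∧ (∀ n x, ‖s n x‖ ≤ C) ∧
      ∀ x, Filter.Tendsto (fun n => s n x) Filter.atTop (nhds (f x)) := by
  obtain ⟨C, hC⟩ := hfb
  refine ⟨max C 0, hf.stronglyMeasurable.approxBounded (max C 0), le_max_right _ _,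
    fun n x => hf.stronglyMeasurable.norm_approxBounded_le (le_max_right _ _) n x, fun x => ?_⟩
  exact hf.stronglyMeasurable.tendsto_approxBounded_of_norm_le ((hC x).trans (le_max_left _ _))

/-- Bootstrapping: if `f ↦ T` is compatible with right multiplication by `A Δ`, it is so for
simple functions. -/
theorem pvm_simple_right (hfin : ∀ φ : H, IsFiniteMeasure (μ φ)) {A : Set X → H →L[ℂ] H}
    (hcompat : ∀ (φ : H) (Δ : Set X), MeasurableSet Δ →
      ((μ φ Δ).toReal : ℂ) = ⟪φ, A Δ φ⟫) {f : X → ℂ} {T : H →L[ℂ] H}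
    (h : ∀ Δ : Set X, MeasurableSet Δ →
      PvmRep μ (fun x => f x * Δ.indicator (fun _ => (1 : ℂ)) x) (T * A Δ))
    (s : SimpleFunc X ℂ) : ∃ S, PvmRep μ s S ∧ PvmRep μ (fun x => f x * s x) (T * S) := by
  induction s using SimpleFunc.induction with
  | @const c Δ hΔ =>
    refine ⟨c • A Δ, ?_, ?_⟩
    · convert (pvmRep_indicator hcompat hΔ).smul c using 1
      ext x
      by_cases hx : x ∈ Δ <;> simp [hx]
    · convert (h Δ hΔ).smul c using 1
      · ext x
        by_cases hx : x ∈ Δ <;> simp [hx, mul_comm]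
      · simp
  | @add s t _ hs ht =>
    obtain ⟨S, h1, h2⟩ := hs
    obtain ⟨S', h3, h4⟩ := ht
    refine ⟨S + S', ?_, ?_⟩
    · simpa using h1.add hfin h3
    · convert h2.add hfin h4 using 1
      · ext x
        simp [mul_add]
      · rw [mul_add]

theorem pvm_simple_left (hfin : ∀ φ : H, IsFiniteMeasure (μ φ)) {A : Set X → H →L[ℂ] H}
    (hcompat : ∀ (φ : H) (Δ : Set X), MeasurableSet Δ →
      ((μ φ Δ).toReal : ℂ) = ⟪φ, A Δ φ⟫)
    (hproj : ∀ Δ Δ' : Set X, MeasurableSet Δ → MeasurableSet Δ' →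
      A (Δ ∩ Δ') = A Δ * A Δ') {Δ : Set X} (hΔ : MeasurableSet Δ)
    (s : SimpleFunc X ℂ) : ∃ S, PvmRep μ s S ∧
      PvmRep μ (fun x => s x * Δ.indicator (fun _ => (1 : ℂ)) x) (S * A Δ) := by
  induction s using SimpleFunc.induction with
  | @const c D hD =>
    refine ⟨c • A D, ?_, ?_⟩
    · convert (pvmRep_indicator hcompat hD).smul c using 1
      ext x
      by_cases hx : x ∈ D <;> simp [hx]
    · convert (pvmRep_indicator hcompat (hD.inter hΔ)).smul c using 1
      · ext x
        by_cases hx : x ∈ D <;> by_cases hy : x ∈ Δ <;> simp [hx, hy]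
      · rw [hproj D Δ hD hΔ, smul_mul_assoc]
  | @add s t _ hs ht =>
    obtain ⟨S, h1, h2⟩ := hs
    obtain ⟨S', h3, h4⟩ := ht
    refine ⟨S + S', ?_, ?_⟩
    · simpa using h1.add hfin h3
    · convert h2.add hfin h4 using 1
      · ext x
        simp only [SimpleFunc.coe_add, Pi.add_apply, add_mul]
      · rw [add_mul]

end helpers

/-- If a POVM `A` is projection-valued, i.e. `A(Δ ∩ Δ') = A(Δ)A(Δ')` for all measurable
`Δ, Δ'`, then integration against `A` is multiplicative: `Q(fg) = Q(f)Q(g)` for all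
bounded measurable `f, g : X → ℂ`. -/
theorem pvm_integral_multiplicative
    {X : Type*} [MeasurableSpace X]
    {H : Type*} [NormedAddCommGroup H] [InnerProductSpace ℂ H] [CompleteSpace H]
    (A : Set X → H →L[ℂ] H) (μ : H → Measure X)
    (hempty : A ∅ = 0)
    (hpos : ∀ Δ : Set X, MeasurableSet Δ → (A Δ).IsPositive)
    (hfin : ∀ φ : H, IsFiniteMeasure (μ φ))
    (hcompat : ∀ (φ : H) (Δ : Set X), MeasurableSet Δ →
      ((μ φ Δ).toReal : ℂ) = ⟪φ, A Δ φ⟫)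
    (hproj : ∀ Δ Δ' : Set X, MeasurableSet Δ → MeasurableSet Δ' →
      A (Δ ∩ Δ') = A Δ * A Δ')
    (f g : X → ℂ)
    (hf : Measurable f) (hfb : ∃ C : ℝ, ∀ x, ‖f x‖ ≤ C)
    (hg : Measurable g) (hgb : ∃ C : ℝ, ∀ x, ‖g x‖ ≤ C)
    (Tf Tg Tfg : H →L[ℂ] H)
    (hTf : ∀ φ : H, ⟪φ, Tf φ⟫ = ∫ x, f x ∂(μ φ))
    (hTg : ∀ φ : H, ⟪φ, Tg φ⟫ = ∫ x, g x ∂(μ φ))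
    (hTfg : ∀ φ : H, ⟪φ, Tfg φ⟫ = ∫ x, f x * g x ∂(μ φ)) :
    Tfg = Tf * Tg := by
  have Rf : PvmRep μ f Tf := ⟨hf, hfb, hTf⟩
  have Rg : PvmRep μ g Tg := ⟨hg, hgb, hTg⟩
  have step1 : ∀ Δ : Set X, MeasurableSet Δ →
      PvmRep μ (fun x => f x * Δ.indicator (fun _ => (1 : ℂ)) x) (Tf * A Δ) := by
    intro Δ hΔ
    have hI := pvmRep_indicator (μ := μ) hcompat hΔ
    have hI1 : ∀ x, ‖Δ.indicator (fun _ => (1 : ℂ)) x‖ ≤ 1 := by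
      intro x
      by_cases hx : x ∈ Δ <;> simp [hx]
    obtain ⟨C, s, hC0, hC, hl⟩ := pvm_approx hf hfb
    choose S hS1 hS2 using fun n => pvm_simple_left hfin hcompat hproj hΔ (s n)
    have hb : ∀ (z : ℂ) x, ‖z‖ ≤ C → ‖z * Δ.indicator (fun _ => (1 : ℂ)) x‖ ≤ C := by
      intro z x hz
      rw [norm_mul]
      exact (mul_le_of_le_one_right (norm_nonneg _) (hI1 x)).trans hz
    refine ⟨hf.mul hI.1, ⟨C, fun x => hb _ _ ?_⟩, fun φ => ?_⟩
    · exact le_of_tendsto (hl x).norm (Filter.Eventually.of_forall fun n => hC n x)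
    · have hw := pvm_weak (F := S) (T := Tf) (fun χ => by
        simp only [(hS1 _).2.2, hTf]
        exact pvm_dct hfin (fun n => (s n).measurable) hC hl χ) φ (A Δ φ)
      have hd := pvm_dct (μ := μ) hfin (fun n => (hS2 n).1) (fun n x => hb _ x (hC n x))
        (fun x => (hl x).mul_const _) φ
      simp only [← (hS2 _).2.2] at hd
      exact tendsto_nhds_unique hw hd
  obtain ⟨C, s, hC0, hC, hl⟩ := pvm_approx hg hgb
  obtain ⟨D, hD⟩ := hfb
  choose S hS1 hS2 using fun n => pvm_simple_right hfin hcompat step1 (s n)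
  have main : ∀ φ : H, ⟪φ, (Tf * Tg) φ⟫ = ⟪φ, Tfg φ⟫ := by
    intro φ
    have hw := pvm_weak (F := S) (T := Tg) (fun χ => by
        simp only [(hS1 _).2.2, hTg]
        exact pvm_dct hfin (fun n => (s n).measurable) hC hl χ)
        (ContinuousLinearMap.adjoint Tf φ) φ
    simp only [ContinuousLinearMap.adjoint_inner_left] at hw
    have hd := pvm_dct (μ := μ) (C := D * C) hfin (fun n => (hS2 n).1) (fun n x => by
        rw [norm_mul]
        exact mul_le_mul (hD x) (hC n x) (norm_nonneg _) ((norm_nonneg _).trans (hD x)))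
        (fun x => (hl x).const_mul (f x)) φ
    simp only [← (hS2 _).2.2] at hd
    rw [hTfg]
    exact tendsto_nhds_unique hw hd
  have hlin : (Tfg : H →ₗ[ℂ] H) = ((Tf * Tg : H →L[ℂ] H) : H →ₗ[ℂ] H) := by
    rw [← ext_inner_map]
    intro φ
    rw [← inner_conj_symm, ← inner_conj_symm _ φ]
    exact congrArg _ (main φ).symm
  exact ContinuousLinearMap.coe_injective hlin
end

section
/- Let A and B be C*-algebras and let {Q_ℏ}_{ℏ∈(0,1]} : A → B be a positive asymptotic morphism. Then for every f ∈ A, limsup_{ℏ→0} ‖Q_ℏ(f)‖ ≤ ‖f‖. -/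
open Filter
open scoped ENNReal NNReal

lemma aux_unital {C : Type*} [CStarAlgebra C] (c b : C) (hb : star b = b) (ε : ℝ)
    (h : ‖star c * c - (b + b - b * b)‖ ≤ ε) : ‖star c * c‖ ≤ 1 + ε := by
  let _ := CStarAlgebra.spectralOrder C
  have _ := CStarAlgebra.spectralOrderedRing C
  have hε : 0 ≤ ε := (norm_nonneg _).trans h
  have he : IsSelfAdjoint (star c * c - (b + b - b * b)) := by
    simp [IsSelfAdjoint, hb]
  have h1 : star c * c - (b + b - b * b) ≤ algebraMap ℝ C ε :=
    he.le_algebraMap_norm_self.trans (algebraMap_mono C h)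
  have h2 : 0 ≤ star (1 - b) * (1 - b) := star_mul_self_nonneg _
  rw [CStarAlgebra.norm_le_iff_le_algebraMap _ (by positivity) (star_mul_self_nonneg c)]
  rw [map_add, map_one]
  have h6 : star c * c = (star c * c - (b + b - b * b)) + (1 - star (1 - b) * (1 - b)) := by
    simp only [star_sub, star_one, hb]; noncomm_ring
  rw [h6, add_comm]
  exact add_le_add (sub_le_self _ h2) h1

lemma aux_nonunital {C : Type*} [NonUnitalCStarAlgebra C] (c b : C) (hb : star b = b) (ε : ℝ)
    (h : ‖star c * c - (b + b - b * b)‖ ≤ ε) : ‖star c * c‖ ≤ 1 + ε := by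
  have := aux_unital (C := Unitization ℂ C) (c : Unitization ℂ C) b
    (by rw [← Unitization.inr_star, hb]) ε (by
      rw [← Unitization.norm_inr (𝕜 := ℂ)] at h
      simpa using h)
  rw [← Unitization.norm_inr (𝕜 := ℂ)]
  simpa using this

lemma aux_exists {A : Type*} [NonUnitalCStarAlgebra A] (f : A) (hf : ‖f‖ ≤ 1) :
    ∃ h : A, star h = h ∧ star f * f = h + h - h * h := by
  let _ := CStarAlgebra.spectralOrder A
  have _ := CStarAlgebra.spectralOrderedRing A
  have ha : IsSelfAdjoint (star f * f) := IsSelfAdjoint.star_mul_self f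
  have hn : ‖star f * f‖ ≤ 1 := by
    rw [CStarRing.norm_star_mul_self]; nlinarith [norm_nonneg f]
  have hq : ∀ x ∈ quasispectrum ℝ (star f * f), x ≤ 1 := fun x hx =>
    (Real.le_norm_self x).trans ((NonUnitalIsometricContinuousFunctionalCalculus.norm_quasispectrum_le _ hx ha).trans hn)
  refine ⟨cfcₙ (fun x : ℝ => 1 - √(1 - x)) (star f * f), cfcₙ_predicate (R := ℝ) (p := IsSelfAdjoint) _ _, ?_⟩
  rw [← cfcₙ_mul .., ← cfcₙ_add .., ← cfcₙ_sub ..]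
  conv_lhs => rw [← cfcₙ_id' ℝ (star f * f)]
  refine cfcₙ_congr fun x hx => ?_
  have := Real.mul_self_sqrt (sub_nonneg.2 (hq x hx))
  linarith

lemma aux_star {A B : Type*} [NonUnitalCStarAlgebra A] [NonUnitalCStarAlgebra B]
    (Q : A →ₗ[ℂ] B)
    (hpos : ∀ a : A, (∃ b : A, a = star b * b) → ∃ c : B, Q a = star c * c) (f : A) :
    Q (star f) = star (Q f) := by
  let _ := CStarAlgebra.spectralOrder A
  have _ := CStarAlgebra.spectralOrderedRing A
  have hf : f ∈ Submodule.span ℂ {a : A | 0 ≤ a} := by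
    rw [CStarAlgebra.span_nonneg]; trivial
  induction hf using Submodule.span_induction with
  | mem x hx =>
    obtain ⟨c, hc⟩ := hpos x (CStarAlgebra.nonneg_iff_eq_star_mul_self.1 hx)
    rw [(IsSelfAdjoint.of_nonneg (show 0 ≤ x from hx)).star_eq, hc]; simp
  | zero => simp
  | add x y _ _ hx hy => simp [hx, hy]
  | smul a x _ hx => simp [hx]

/-- For a positive asymptotic morphism `{Q_ℏ}_{ℏ ∈ (0,1]} : A → B` between C*-algebras
(each `Q_ℏ` a positive linear map, `ℏ ↦ Q_ℏ(f)` continuous, and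
`‖Q_ℏ(fg) − Q_ℏ(f)Q_ℏ(g)‖ → 0` as `ℏ → 0`), one has `limsup_{ℏ → 0} ‖Q_ℏ(f)‖ ≤ ‖f‖`
for every `f ∈ A`. -/
theorem positive_asymptotic_morphism_limsup_norm_le
    {A B : Type*} [NonUnitalCStarAlgebra A] [NonUnitalCStarAlgebra B]
    (Q : ℝ → A →ₗ[ℂ] B)
    (hpos : ∀ ℏ ∈ Set.Ioc (0 : ℝ) 1, ∀ a : A,
      (∃ b : A, a = star b * b) → ∃ c : B, Q ℏ a = star c * c)
    (hcont : ∀ f : A, ContinuousOn (fun ℏ => Q ℏ f) (Set.Ioc (0 : ℝ) 1))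
    (hmul : ∀ f g : A, Tendsto (fun ℏ => ‖Q ℏ (f * g) - Q ℏ f * Q ℏ g‖)
      (nhdsWithin 0 (Set.Ioc (0 : ℝ) 1)) (nhds 0)) :
    ∀ f : A, Filter.limsup (fun ℏ => (‖Q ℏ f‖₊ : ℝ≥0∞))
      (nhdsWithin 0 (Set.Ioc (0 : ℝ) 1)) ≤ (‖f‖₊ : ℝ≥0∞) := by
  have key : ∀ f : A, ‖f‖ ≤ 1 → ∀ δ > 0,
      ∀ᶠ ℏ in nhdsWithin 0 (Set.Ioc (0 : ℝ) 1), ‖Q ℏ f‖ ^ 2 ≤ 1 + δ := by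
    intro f hf δ hδ
    obtain ⟨h, hsa, hh⟩ := aux_exists f hf
    filter_upwards [(hmul (star f) f).eventually_lt_const (half_pos hδ),
      (hmul h h).eventually_lt_const (half_pos hδ), self_mem_nhdsWithin] with ℏ h1 h2 hI
    have hst := aux_star (Q ℏ) (hpos ℏ hI)
    obtain ⟨c, hc⟩ := hpos ℏ hI (star f * f) ⟨f, rfl⟩
    have h3 : ‖star c * c‖ ≤ 1 + δ / 2 := by
      refine aux_nonunital c (Q ℏ h) (by rw [← hst, hsa]) _ ?_
      rw [← hc, hh, map_sub, map_add, sub_sub_sub_cancel_left, norm_sub_rev]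
      exact h2.le
    rw [hst, hc, norm_sub_rev] at h1
    have h4 := norm_le_norm_add_norm_sub' (star (Q ℏ f) * Q ℏ f) (star c * c)
    rw [CStarRing.norm_star_mul_self] at h4
    nlinarith
  intro f
  refine ENNReal.le_of_forall_pos_le_add fun ε hε _ => ?_
  refine limsup_le_of_le (by isBoundedDefault) ?_
  set r : ℝ := ‖f‖ + ε with hr
  have hε' : (0 : ℝ) < ε := hε
  set s : ℝ := ‖f‖ + ε / 2 with hs
  have hs0 : 0 < s := by positivity
  have hsr : s < r := by rw [hr, hs]; linarith
  have hδ : 0 < (r / s) ^ 2 - 1 := by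
    have : 1 < r / s := (one_lt_div hs0).2 hsr
    nlinarith
  have hn : ‖((s⁻¹ : ℝ) : ℂ) • f‖ ≤ 1 := by
    rw [norm_smul, Complex.norm_real, Real.norm_of_nonneg (by positivity), inv_mul_le_one₀ hs0]
    rw [hs]; linarith
  filter_upwards [key _ hn _ hδ] with ℏ hℏ
  rw [map_smul, norm_smul, Complex.norm_real, Real.norm_of_nonneg (by positivity), add_sub_cancel] at hℏ
  have h5 := (pow_le_pow_iff_left₀ (by positivity) (by positivity) two_ne_zero).1 hℏ
  rw [inv_mul_eq_div, div_le_div_iff_of_pos_right hs0] at h5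
  have h6 : ‖Q ℏ f‖₊ ≤ ‖f‖₊ + ε := by
    rw [← NNReal.coe_le_coe]; simpa [hr] using h5
  exact_mod_cast h6
end

section
/- Let X be a σ-compact, second countable, locally compact Hausdorff space with Borel σ-algebra Σ_X, and let H be a complex Hilbert space. Let {A_ℏ}_{ℏ∈(0,1]} and {B_ℏ}_{ℏ∈(0,1]} be two families of Borel POVMs on X with values in B(H), each satisfying limsup_{ℏ→0} ‖A_ℏ(X)‖ ≤ 1 and limsup_{ℏ→0} ‖B_ℏ(X)‖ ≤ 1, which are equivalent in the sense that ‖A_ℏ(U) − B_ℏ(U)‖ → 0 as ℏ → 0 for every open set U ⊆ X with compact closure. Then the associated integration maps are equivalent: for every f ∈ C₀(X, ℂ), ‖∫_X f dA_ℏ − ∫_X f dB_ℏ‖ → 0 as ℏ → 0. -/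
open MeasureTheory Filter
open scoped ComplexInnerProductSpace ZeroAtInfty ENNReal NNReal

/-- The operator norm is controlled by the quadratic form. -/
lemma aux_norm_le_of_form {H : Type*} [NormedAddCommGroup H] [InnerProductSpace ℂ H]
    (T : H →L[ℂ] H) (c : ℝ) (hc : 0 ≤ c) (h : ∀ φ : H, ‖⟪φ, T φ⟫‖ ≤ c * ‖φ‖ ^ 2) :
    ‖T‖ ≤ 2 * c := by
  have key : ∀ x y : H, ‖⟪y, T x⟫‖ ≤ c * (‖x‖ ^ 2 + ‖y‖ ^ 2) := by
    intro x y
    have e : 4 * ⟪y, T x⟫ = ⟪x + y, T (x + y)⟫ - ⟪x - y, T (x - y)⟫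
        + Complex.I * ⟪y + Complex.I • x, T (y + Complex.I • x)⟫ * (-1)
        + Complex.I * ⟪y - Complex.I • x, T (y - Complex.I • x)⟫ := by
      simp only [map_add, map_sub, map_smul, inner_add_left, inner_add_right, inner_sub_left,
        inner_sub_right, inner_smul_left, inner_smul_right, Complex.conj_I]
      ring_nf
      simp only [Complex.I_sq]
      ring
    have h1 := h (x + y)
    have h2 := h (x - y)
    have h3 := h (y + Complex.I • x)
    have h4 := h (y - Complex.I • x)
    have p1 := parallelogram_law_with_norm ℂ x y
    have p2 := parallelogram_law_with_norm ℂ y (Complex.I • x)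
    have hI : ‖Complex.I • x‖ = ‖x‖ := by simp [norm_smul]
    rw [hI] at p2
    have n : ‖4 * ⟪y, T x⟫‖ ≤ ‖⟪x + y, T (x + y)⟫‖ + ‖⟪x - y, T (x - y)⟫‖
        + ‖⟪y + Complex.I • x, T (y + Complex.I • x)⟫‖
        + ‖⟪y - Complex.I • x, T (y - Complex.I • x)⟫‖ := by
      rw [e]
      refine (norm_add_le _ _).trans (add_le_add ((norm_add_le _ _).trans
        (add_le_add (norm_sub_le _ _) ?_)) ?_) <;> simp
    rw [norm_mul, show ‖(4 : ℂ)‖ = 4 by norm_num] at n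
    have : c * (‖x + y‖ ^ 2 + ‖x - y‖ ^ 2 + (‖y + Complex.I • x‖ ^ 2 + ‖y - Complex.I • x‖ ^ 2))
        = c * (4 * (‖x‖ ^ 2 + ‖y‖ ^ 2)) := by
      congr 1
      nlinarith
    nlinarith
  refine T.opNorm_le_bound (by positivity) fun x => ?_
  rcases eq_or_ne (T x) 0 with h0 | h0
  · rw [h0, norm_zero]; positivity
  have hT : 0 < ‖T x‖ := norm_pos_iff.2 h0
  have hx : 0 < ‖x‖ := norm_pos_iff.2 (by rintro rfl; simp at h0)
  have k := key x (((‖x‖ / ‖T x‖ : ℝ) : ℂ) • T x)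
  rw [inner_smul_left, inner_self_eq_norm_sq_to_K, norm_smul, norm_mul] at k
  simp only [Complex.conj_ofReal, Complex.norm_real, norm_div, norm_norm, norm_pow,
    Complex.coe_algebraMap, RCLike.norm_ofReal, abs_norm] at k
  have e1 : ‖x‖ / ‖T x‖ * ‖T x‖ ^ 2 = ‖x‖ * ‖T x‖ := by field_simp
  have e2 : ‖x‖ / ‖T x‖ * ‖T x‖ = ‖x‖ := by field_simp
  rw [e1, e2] at k
  have : ‖x‖ * ‖T x‖ ≤ ‖x‖ * (2 * c * ‖x‖) := by linarith
  exact le_of_mul_le_mul_left this hx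

lemma aux_step (ε g : ℝ) (hε : 0 < ε) (hg : 0 ≤ g) (N : ℕ) :
    ((N : ℝ) * ε < g → ε * ∑ k ∈ Finset.range N, (if ((k : ℝ) + 1) * ε < g then (1 : ℝ) else 0)
      = N * ε) ∧
    (g ≤ N * ε →
      |g - ε * ∑ k ∈ Finset.range N, (if ((k : ℝ) + 1) * ε < g then (1 : ℝ) else 0)| ≤ ε) := by
  induction N with
  | zero => 
    refine ⟨by simp, fun h => ?_⟩
    have : g = 0 := le_antisymm (by simpa using h) hg
    simp [this, hε.le]
  | succ N ih =>
    rw [Finset.sum_range_succ, mul_add]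
    push_cast
    constructor
    · intro h
      rw [ih.1 (by nlinarith), if_pos h]; ring
    · intro h
      rw [if_neg (not_lt.2 h), mul_zero, add_zero]
      by_cases h' : (N : ℝ) * ε < g
      · rw [ih.1 h', abs_le]; constructor <;> nlinarith
      · exact ih.2 (not_lt.1 h')

lemma aux_measure {X : Type*} [MeasurableSpace X] (μ : Measure X) [IsFiniteMeasure μ]
    (g : X → ℝ) (hgm : Measurable g) (hg : ∀ x, 0 ≤ g x) (ε : ℝ) (hε : 0 < ε) (N : ℕ)
    (hN : ∀ x, g x ≤ N * ε) :
    |∫ x, g x ∂μ - ε * ∑ k ∈ Finset.range N, μ.real {x | ((k : ℝ) + 1) * ε < g x}|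
      ≤ ε * μ.real Set.univ := by
  have hms : ∀ k : ℕ, MeasurableSet {x | ((k : ℝ) + 1) * ε < g x} := fun k =>
    measurableSet_lt measurable_const hgm
  have hi : ∀ k : ℕ, Integrable (fun x => if ((k : ℝ) + 1) * ε < g x then (1 : ℝ) else 0) μ := by
    intro k
    exact (integrable_const (1 : ℝ)).indicator (hms k)
  have hgi : Integrable g μ := by
    refine Integrable.of_bound hgm.aestronglyMeasurable (N * ε) (ae_of_all _ fun x => ?_)
    rw [Real.norm_eq_abs, abs_of_nonneg (hg x)]; exact hN x
  have hv : ∀ k : ℕ, ∫ x, (if ((k : ℝ) + 1) * ε < g x then (1 : ℝ) else 0) ∂μ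
      = μ.real {x | ((k : ℝ) + 1) * ε < g x} := by
    intro k
    exact integral_indicator_one (hms k)
  have e : ∫ x, g x ∂μ - ε * ∑ k ∈ Finset.range N, μ.real {x | ((k : ℝ) + 1) * ε < g x}
      = ∫ x, (g x - ε * ∑ k ∈ Finset.range N,
          (if ((k : ℝ) + 1) * ε < g x then (1 : ℝ) else 0)) ∂μ := by
    rw [integral_sub hgi ((integrable_finsetSum _ fun k _ => hi k).const_mul ε),
      integral_const_mul, integral_finsetSum _ fun k _ => hi k]
    simp only [hv]
  rw [e, ← Real.norm_eq_abs]
  exact norm_integral_le_of_norm_le_const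
    (ae_of_all _ fun x => (aux_step ε (g x) hε (hg x) N).2 (hN x))

lemma aux_form {H : Type*} [NormedAddCommGroup H] [InnerProductSpace ℂ H]
    (T : H →L[ℂ] H) (φ : H) : ‖⟪φ, T φ⟫‖ ≤ ‖T‖ * ‖φ‖ ^ 2 := by
  have h1 := norm_inner_le_norm (𝕜 := ℂ) φ (T φ)
  have h2 := T.le_opNorm φ
  nlinarith [norm_nonneg φ]

lemma aux_real
    {X : Type*} [TopologicalSpace X] [T2Space X] [MeasurableSpace X] [BorelSpace X]
    {H : Type*} [NormedAddCommGroup H] [InnerProductSpace ℂ H]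
    (A B : ℝ → Set X → H →L[ℂ] H) (μA μB : ℝ → H → Measure X)
    (hAfin : ∀ ℏ ∈ Set.Ioc (0 : ℝ) 1, ∀ φ : H, IsFiniteMeasure (μA ℏ φ))
    (hBfin : ∀ ℏ ∈ Set.Ioc (0 : ℝ) 1, ∀ φ : H, IsFiniteMeasure (μB ℏ φ))
    (hAcompat : ∀ ℏ ∈ Set.Ioc (0 : ℝ) 1, ∀ (φ : H) (Δ : Set X), MeasurableSet Δ →
      ((μA ℏ φ Δ).toReal : ℂ) = ⟪φ, A ℏ Δ φ⟫)
    (hBcompat : ∀ ℏ ∈ Set.Ioc (0 : ℝ) 1, ∀ (φ : H) (Δ : Set X), MeasurableSet Δ →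
      ((μB ℏ φ Δ).toReal : ℂ) = ⟪φ, B ℏ Δ φ⟫)
    (hAbound : Filter.limsup (fun ℏ => (‖A ℏ Set.univ‖₊ : ℝ≥0∞))
      (nhdsWithin 0 (Set.Ioc (0 : ℝ) 1)) ≤ 1)
    (hBbound : Filter.limsup (fun ℏ => (‖B ℏ Set.univ‖₊ : ℝ≥0∞))
      (nhdsWithin 0 (Set.Ioc (0 : ℝ) 1)) ≤ 1)
    (hequiv : ∀ U : Set X, IsOpen U → IsCompact (closure U) →
      Tendsto (fun ℏ => ‖A ℏ U - B ℏ U‖) (nhdsWithin 0 (Set.Ioc (0 : ℝ) 1)) (nhds 0))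
    (g : X → ℝ) (hgc : Continuous g) (hg : ∀ x, 0 ≤ g x) (M : ℝ) (hM : ∀ x, g x ≤ M)
    (hg0 : Tendsto g (cocompact X) (nhds 0)) (δ : ℝ) (hδ : 0 < δ) :
    ∀ᶠ ℏ in nhdsWithin 0 (Set.Ioc (0 : ℝ) 1), ∀ φ : H,
      |∫ x, g x ∂(μA ℏ φ) - ∫ x, g x ∂(μB ℏ φ)| ≤ δ * ‖φ‖ ^ 2 := by
  set ε : ℝ := δ / 5 with hεd
  have hε : 0 < ε := by positivity
  obtain ⟨N, hN⟩ := exists_nat_ge (M / ε)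
  have hN' : ∀ x, g x ≤ N * ε := fun x => (hM x).trans ((div_le_iff₀ hε).1 hN)
  let U : ℕ → Set X := fun k => {x | ((k : ℝ) + 1) * ε < g x}
  have hUo : ∀ k, IsOpen (U k) := fun k => isOpen_lt continuous_const hgc
  have hUc : ∀ k, IsCompact (closure (U k)) := by
    intro k
    have hp : (0 : ℝ) < (k + 1) * ε := by positivity
    have hev := hg0.eventually (gt_mem_nhds hp)
    obtain ⟨K, hK, hKs⟩ := mem_cocompact.1 hev
    refine hK.closure_of_subset fun x hx => ?_
    by_contra hxK
    have a1 : g x < (k + 1) * ε := hKs hxK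
    have a2 : (k + 1) * ε < g x := hx
    exact lt_asymm a1 a2
  have hsum : Tendsto (fun ℏ => ε * ∑ k ∈ Finset.range N, ‖A ℏ (U k) - B ℏ (U k)‖)
      (nhdsWithin 0 (Set.Ioc (0 : ℝ) 1)) (nhds 0) := by
    have := (tendsto_finsetSum (Finset.range N) fun k _ => hequiv (U k) (hUo k) (hUc k)).const_mul ε
    simpa using this
  have bd : ∀ C : ℝ → Set X → H →L[ℂ] H, Filter.limsup (fun ℏ => (‖C ℏ Set.univ‖₊ : ℝ≥0∞))
      (nhdsWithin 0 (Set.Ioc (0 : ℝ) 1)) ≤ 1 →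
      ∀ᶠ ℏ in nhdsWithin 0 (Set.Ioc (0 : ℝ) 1), ‖C ℏ Set.univ‖ ≤ 2 := by
    intro C hC
    have := eventually_lt_of_limsup_lt (hC.trans_lt (by norm_num : (1 : ℝ≥0∞) < 2))
    filter_upwards [this] with ℏ h
    have h' : ‖C ℏ Set.univ‖₊ < 2 := by exact_mod_cast h
    exact_mod_cast h'.le
  filter_upwards [bd A hAbound, bd B hBbound, hsum.eventually (gt_mem_nhds hε),
    self_mem_nhdsWithin] with ℏ hA hB hs hℏ φ
  haveI := hAfin ℏ hℏ φ
  haveI := hBfin ℏ hℏ φ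
  have mA := aux_measure (μA ℏ φ) g hgc.measurable hg ε hε N hN'
  have mB := aux_measure (μB ℏ φ) g hgc.measurable hg ε hε N hN'
  have uA : (μA ℏ φ).real Set.univ ≤ 2 * ‖φ‖ ^ 2 := by
    have h1 := aux_form (A ℏ Set.univ) φ
    rw [← hAcompat ℏ hℏ φ _ MeasurableSet.univ, Complex.norm_real] at h1
    exact (le_abs_self _).trans (h1.trans (by gcongr))
  have uB : (μB ℏ φ).real Set.univ ≤ 2 * ‖φ‖ ^ 2 := by
    have h1 := aux_form (B ℏ Set.univ) φ
    rw [← hBcompat ℏ hℏ φ _ MeasurableSet.univ, Complex.norm_real] at h1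
    exact (le_abs_self _).trans (h1.trans (by gcongr))
  have hd : ∀ k, |(μA ℏ φ).real (U k) - (μB ℏ φ).real (U k)|
      ≤ ‖A ℏ (U k) - B ℏ (U k)‖ * ‖φ‖ ^ 2 := by
    intro k
    have h1 := aux_form (A ℏ (U k) - B ℏ (U k)) φ
    rw [ContinuousLinearMap.sub_apply, inner_sub_right,
      ← hAcompat ℏ hℏ φ _ (hUo k).measurableSet, ← hBcompat ℏ hℏ φ _ (hUo k).measurableSet,
      ← Complex.ofReal_sub, Complex.norm_real] at h1
    exact h1
  have hd2 : |ε * ∑ k ∈ Finset.range N, (μA ℏ φ).real (U k)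
      - ε * ∑ k ∈ Finset.range N, (μB ℏ φ).real (U k)| ≤ ε * ‖φ‖ ^ 2 := by
    rw [← mul_sub, ← Finset.sum_sub_distrib, abs_mul, abs_of_pos hε]
    calc ε * |∑ k ∈ Finset.range N, ((μA ℏ φ).real (U k) - (μB ℏ φ).real (U k))|
        ≤ ε * ∑ k ∈ Finset.range N, ‖A ℏ (U k) - B ℏ (U k)‖ * ‖φ‖ ^ 2 := by
          gcongr
          exact (Finset.abs_sum_le_sum_abs _ _).trans (Finset.sum_le_sum fun k _ => hd k)
      _ = (ε * ∑ k ∈ Finset.range N, ‖A ℏ (U k) - B ℏ (U k)‖) * ‖φ‖ ^ 2 := by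
          rw [← Finset.sum_mul, mul_assoc]
      _ ≤ ε * ‖φ‖ ^ 2 := by gcongr
  have uA' := mul_le_mul_of_nonneg_left uA hε.le
  have uB' := mul_le_mul_of_nonneg_left uB hε.le
  have hδε : δ * ‖φ‖ ^ 2 = 5 * (ε * ‖φ‖ ^ 2) := by rw [hεd]; ring
  rw [hδε]
  change |_ - ε * ∑ k ∈ Finset.range N, (μA ℏ φ).real (U k)| ≤ _ at mA
  change |_ - ε * ∑ k ∈ Finset.range N, (μB ℏ φ).real (U k)| ≤ _ at mB
  rw [abs_le] at *
  constructor <;> linarith [mA.1, mA.2, mB.1, mB.2, hd2.1, hd2.2]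

/-- If two families of Borel POVMs `{A_ℏ}` and `{B_ℏ}` on a σ-compact second countable
locally compact Hausdorff space `X`, each with `limsup_{ℏ→0} ‖·(X)‖ ≤ 1`, are equivalent
(`‖A_ℏ(U) − B_ℏ(U)‖ → 0` for every pre-compact open `U`), then their integration maps are
equivalent: `‖∫ f dA_ℏ − ∫ f dB_ℏ‖ → 0` for all `f ∈ C₀(X, ℂ)`. -/
theorem equivalent_asms_integrate_equivalently
    {X : Type*} [TopologicalSpace X] [SecondCountableTopology X] [LocallyCompactSpace X]
    [T2Space X] [SigmaCompactSpace X] [MeasurableSpace X] [BorelSpace X]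
    {H : Type*} [NormedAddCommGroup H] [InnerProductSpace ℂ H] [CompleteSpace H]
    (A B : ℝ → Set X → H →L[ℂ] H) (μA μB : ℝ → H → Measure X)
    (hAempty : ∀ ℏ ∈ Set.Ioc (0 : ℝ) 1, A ℏ ∅ = 0)
    (hBempty : ∀ ℏ ∈ Set.Ioc (0 : ℝ) 1, B ℏ ∅ = 0)
    (hApos : ∀ ℏ ∈ Set.Ioc (0 : ℝ) 1, ∀ Δ : Set X, MeasurableSet Δ → (A ℏ Δ).IsPositive)
    (hBpos : ∀ ℏ ∈ Set.Ioc (0 : ℝ) 1, ∀ Δ : Set X, MeasurableSet Δ → (B ℏ Δ).IsPositive)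
    (hAfin : ∀ ℏ ∈ Set.Ioc (0 : ℝ) 1, ∀ φ : H, IsFiniteMeasure (μA ℏ φ))
    (hBfin : ∀ ℏ ∈ Set.Ioc (0 : ℝ) 1, ∀ φ : H, IsFiniteMeasure (μB ℏ φ))
    (hAcompat : ∀ ℏ ∈ Set.Ioc (0 : ℝ) 1, ∀ (φ : H) (Δ : Set X), MeasurableSet Δ →
      ((μA ℏ φ Δ).toReal : ℂ) = ⟪φ, A ℏ Δ φ⟫)
    (hBcompat : ∀ ℏ ∈ Set.Ioc (0 : ℝ) 1, ∀ (φ : H) (Δ : Set X), MeasurableSet Δ →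
      ((μB ℏ φ Δ).toReal : ℂ) = ⟪φ, B ℏ Δ φ⟫)
    (hAbound : Filter.limsup (fun ℏ => (‖A ℏ Set.univ‖₊ : ℝ≥0∞))
      (nhdsWithin 0 (Set.Ioc (0 : ℝ) 1)) ≤ 1)
    (hBbound : Filter.limsup (fun ℏ => (‖B ℏ Set.univ‖₊ : ℝ≥0∞))
      (nhdsWithin 0 (Set.Ioc (0 : ℝ) 1)) ≤ 1)
    (hequiv : ∀ U : Set X, IsOpen U → IsCompact (closure U) →
      Tendsto (fun ℏ => ‖A ℏ U - B ℏ U‖) (nhdsWithin 0 (Set.Ioc (0 : ℝ) 1)) (nhds 0))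
    (QA QB : ℝ → C₀(X, ℂ) → (H →L[ℂ] H))
    (hQA : ∀ ℏ ∈ Set.Ioc (0 : ℝ) 1, ∀ (f : C₀(X, ℂ)) (φ : H),
      ⟪φ, QA ℏ f φ⟫ = ∫ x, f x ∂(μA ℏ φ))
    (hQB : ∀ ℏ ∈ Set.Ioc (0 : ℝ) 1, ∀ (f : C₀(X, ℂ)) (φ : H),
      ⟪φ, QB ℏ f φ⟫ = ∫ x, f x ∂(μB ℏ φ)) :
    ∀ f : C₀(X, ℂ), Tendsto (fun ℏ => ‖QA ℏ f - QB ℏ f‖)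
      (nhdsWithin 0 (Set.Ioc (0 : ℝ) 1)) (nhds 0) := by
  intro f
  have hfb : ∀ x, ‖f x‖ ≤ ‖f.toBCF‖ := fun x => f.toBCF.norm_coe_le_norm x
  have hfc : Continuous f := f.continuous
  have hf0 : Tendsto f (cocompact X) (nhds 0) := f.zero_at_infty'
  have R := fun (L : ℂ → ℝ) (hL : Continuous L) (hL0 : L 0 = 0) (hLb : ∀ z, |L z| ≤ ‖z‖) =>
    aux_real A B μA μB hAfin hBfin hAcompat hBcompat hAbound hBbound hequiv
      (fun x => max (L (f x)) 0) ((hL.comp hfc).max continuous_const) (fun x => le_max_right _ _)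
      ‖f.toBCF‖ (fun x => max_le ((le_abs_self _).trans ((hLb _).trans (hfb x))) (norm_nonneg _))
      (by
        have := ((hL.tendsto 0).comp hf0).max (tendsto_const_nhds (x := (0 : ℝ)))
        simpa [hL0] using this)
  have S : ∀ (L : ℂ → ℝ) (hL : Continuous L) (hL0 : L 0 = 0) (hLb : ∀ z, |L z| ≤ ‖z‖),
      ∀ δ : ℝ, 0 < δ → ∀ᶠ ℏ in nhdsWithin 0 (Set.Ioc (0 : ℝ) 1), ∀ φ : H,
      |∫ x, L (f x) ∂(μA ℏ φ) - ∫ x, L (f x) ∂(μB ℏ φ)| ≤ 2 * δ * ‖φ‖ ^ 2 := by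
    intro L hL hL0 hLb δ hδ
    have hLb' : ∀ z, |-L z| ≤ ‖z‖ := fun z => by rw [abs_neg]; exact hLb z
    filter_upwards [R L hL hL0 hLb δ hδ, R (fun z => -L z) hL.neg (by simp [hL0]) hLb' δ hδ,
      self_mem_nhdsWithin] with ℏ h1 h2 hℏ φ
    have split : ∀ μ : Measure X, IsFiniteMeasure μ → ∫ x, L (f x) ∂μ
        = ∫ x, max (L (f x)) 0 ∂μ - ∫ x, max (-L (f x)) 0 ∂μ := by
      intro μ hμ
      have hi : Integrable (fun x => L (f x)) μ :=
        Integrable.of_bound (hL.comp hfc).measurable.aestronglyMeasurable ‖f.toBCF‖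
          (ae_of_all _ fun x => (hLb _).trans (hfb x))
      rw [← integral_sub hi.pos_part hi.neg_part]
      congr 1
      ext x
      exact (max_zero_sub_max_neg_zero_eq_self (L (f x))).symm
    rw [split _ (hAfin ℏ hℏ φ), split _ (hBfin ℏ hℏ φ)]
    have k1 := h1 φ
    have k2 := h2 φ
    rw [abs_le] at *
    constructor <;> linarith [k1.1, k1.2, k2.1, k2.2]
  rw [Metric.tendsto_nhds]
  intro η hη
  have hδ : 0 < η / 16 := by positivity
  filter_upwards [S Complex.re Complex.continuous_re rfl Complex.abs_re_le_norm _ hδ,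
    S Complex.im Complex.continuous_im rfl Complex.abs_im_le_norm _ hδ,
    self_mem_nhdsWithin] with ℏ h1 h2 hℏ
  rw [dist_zero_right, norm_norm]
  have := aux_norm_le_of_form (QA ℏ f - QB ℏ f) (η / 4) (by positivity) ?_
  · linarith
  intro φ
  rw [ContinuousLinearMap.sub_apply, inner_sub_right, hQA ℏ hℏ, hQB ℏ hℏ]
  have hint : ∀ μ : Measure X, IsFiniteMeasure μ → Integrable (fun x => f x) μ := fun μ _ =>
    Integrable.of_bound hfc.measurable.aestronglyMeasurable ‖f.toBCF‖ (ae_of_all _ hfb)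
  have iA := hint _ (hAfin ℏ hℏ φ)
  have iB := hint _ (hBfin ℏ hℏ φ)
  refine (Complex.norm_le_abs_re_add_abs_im _).trans ?_
  have r : ∀ μ : Measure X, Integrable (fun x => f x) μ →
      (∫ x, f x ∂μ).re = ∫ x, (f x).re ∂μ ∧ (∫ x, f x ∂μ).im = ∫ x, (f x).im ∂μ :=
    fun μ h => ⟨(integral_re h).symm, (integral_im h).symm⟩
  rw [Complex.sub_re, Complex.sub_im, (r _ iA).1, (r _ iA).2, (r _ iB).1, (r _ iB).2]
  linarith [h1 φ, h2 φ]
end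

section
/- Let X be a σ-compact, second countable, locally compact Hausdorff space with Borel σ-algebra Σ_X, H a complex Hilbert space, and B ⊆ B(H) a hereditary C*-subalgebra. If A : Σ_X → B(H) is a Borel POVM such that A(U) ∈ B for every open set U ⊆ X with compact closure, then the integration map takes values in B: Q(f) = ∫_X f dA ∈ B for every f ∈ C₀(X, ℂ). -/
open MeasureTheory
open scoped ComplexInnerProductSpace ZeroAtInfty

lemma opNorm_le_of_quadratic {H : Type*} [NormedAddCommGroup H] [InnerProductSpace ℂ H]
    (R : H →L[ℂ] H) (c : ℝ) (hc : 0 ≤ c)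
    (h : ∀ φ : H, ‖⟪φ, R φ⟫‖ ≤ c * ‖φ‖ ^ 2) : ‖R‖ ≤ 4 * c := by
  have key : ∀ x y : H, ‖x‖ = 1 → ‖y‖ = 1 → ‖⟪R y, x⟫‖ ≤ 4 * c := by
    intro x y hx hy
    have h' : ∀ φ : H, ‖φ‖ ≤ 2 → ‖⟪R φ, φ⟫‖ ≤ 4 * c := by
      intro φ hφ
      rw [norm_inner_symm]
      refine (h φ).trans ?_
      have : ‖φ‖ ^ 2 ≤ 2 ^ 2 := by gcongr
      nlinarith
    have hI : ‖Complex.I • y‖ = 1 := by rw [norm_smul, hy]; simp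
    have n1 := h' (x + y) ((norm_add_le _ _).trans (by linarith))
    have n2 := h' (x - y) ((norm_sub_le _ _).trans (by linarith))
    have n3 := h' (x + Complex.I • y) ((norm_add_le _ _).trans (by linarith))
    have n4 := h' (x - Complex.I • y) ((norm_sub_le _ _).trans (by linarith))
    have p := inner_map_polarization (R : H →ₗ[ℂ] H) x y
    simp only [ContinuousLinearMap.coe_coe] at p
    rw [p, norm_div]
    have e4 : ‖(4 : ℂ)‖ = 4 := by simp
    rw [e4, div_le_iff₀ (by norm_num)]
    refine (norm_sub_le _ _).trans ?_
    refine (add_le_add ((norm_add_le _ _).trans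
      (add_le_add (norm_sub_le _ _) le_rfl)) le_rfl).trans ?_
    simp only [norm_mul, Complex.norm_I, one_mul]
    linarith
  refine R.opNorm_le_bound (by positivity) fun y => ?_
  by_cases hy : y = 0
  · simp [hy]
  by_cases hz : R y = 0
  · rw [hz, norm_zero]; positivity
  have hy' : 0 < ‖y‖ := norm_pos_iff.2 hy
  have hz' : 0 < ‖R y‖ := norm_pos_iff.2 hz
  have := key (((‖R y‖⁻¹ : ℝ) : ℂ) • R y) (((‖y‖⁻¹ : ℝ) : ℂ) • y)
    (by rw [norm_smul, Complex.norm_real, norm_inv, norm_norm, inv_mul_cancel₀ hz'.ne'])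
    (by rw [norm_smul, Complex.norm_real, norm_inv, norm_norm, inv_mul_cancel₀ hy'.ne'])
  rw [map_smul, inner_smul_left, inner_smul_right, inner_self_eq_norm_sq_to_K] at this
  simp only [norm_mul, Complex.conj_ofReal, Complex.norm_real, norm_inv, norm_norm, norm_pow,
    Complex.coe_algebraMap] at this
  have e : ‖y‖⁻¹ * (‖R y‖⁻¹ * ‖R y‖ ^ 2) = ‖R y‖ / ‖y‖ := by field_simp
  rw [e, div_le_iff₀ hy'] at this
  exact this

lemma exists_simple_approx {X : Type*} [TopologicalSpace X] [T2Space X]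
    [MeasurableSpace X] [BorelSpace X] (f : C₀(X, ℂ)) (ε : ℝ) (hε : 0 < ε) :
    ∃ (K : Set X) (s : SimpleFunc X ℂ), IsCompact K ∧ (∀ x, x ∉ K → s x = 0) ∧
      ∀ x, ‖f x - s x‖ ≤ ε := by
  obtain ⟨K, hK, hKf⟩ : ∃ K : Set X, IsCompact K ∧ ∀ x, x ∉ K → ‖f x‖ < ε := by
    have := f.zero_at_infty'
    have h2 := this (Metric.ball_mem_nhds 0 hε)
    obtain ⟨K, hK, h⟩ := Filter.mem_cocompact.1 h2
    exact ⟨K, hK, fun x hx => by simpa using h hx⟩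
  have hfK : IsCompact (f '' K) := hK.image (map_continuous f)
  let e := TopologicalSpace.denseSeq ℂ
  obtain ⟨t, ht⟩ := hfK.elim_finite_subcover (fun n => Metric.ball (e n) ε)
    (fun n => Metric.isOpen_ball) (fun z _ => by
      obtain ⟨n, hn⟩ := (TopologicalSpace.denseRange_denseSeq ℂ).exists_dist_lt z hε
      exact Set.mem_iUnion.2 ⟨n, hn⟩)
  let N := t.sup id
  let s0 := (SimpleFunc.nearestPt e N).comp f (map_continuous f).measurable
  refine ⟨K, s0.restrict K, hK, fun x hx => ?_, fun x => ?_⟩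
  · rw [SimpleFunc.restrict_apply _ hK.measurableSet, Set.indicator_of_notMem hx]
  · rw [SimpleFunc.restrict_apply _ hK.measurableSet]
    by_cases hx : x ∈ K
    · rw [Set.indicator_of_mem hx]
      obtain ⟨n, hn⟩ := Set.mem_iUnion.1 (ht ⟨x, hx, rfl⟩)
      obtain ⟨hnt, hn⟩ := Set.mem_iUnion.1 hn
      have h1 := SimpleFunc.edist_nearestPt_le e (f x) (Finset.le_sup (f := id) hnt : n ≤ N)
      have h2 : dist (SimpleFunc.nearestPt e N (f x)) (f x) ≤ dist (e n) (f x) := by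
        rw [edist_dist, edist_dist] at h1
        exact (ENNReal.ofReal_le_ofReal_iff dist_nonneg).1 h1
      rw [← dist_eq_norm, dist_comm]
      rw [Metric.mem_ball, dist_comm] at hn
      exact h2.trans hn.le
    · rw [Set.indicator_of_notMem hx, sub_zero]
      exact (hKf x hx).le

/-- Let `X` be a σ-compact second countable locally compact Hausdorff space and
`B ⊆ B(H)` a hereditary C*-subalgebra of the bounded operators on a complex Hilbert
space `H`.  If a Borel POVM `A` on `X` satisfies `A(U) ∈ B` for every open `U ⊆ X` with
compact closure, then `Q(f) = ∫_X f dA ∈ B` for every `f ∈ C₀(X, ℂ)`. -/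
theorem locally_hereditary_valued_povm_integral_mem
    {X : Type*} [TopologicalSpace X] [SecondCountableTopology X] [LocallyCompactSpace X]
    [T2Space X] [SigmaCompactSpace X] [MeasurableSpace X] [BorelSpace X]
    {H : Type*} [NormedAddCommGroup H] [InnerProductSpace ℂ H] [CompleteSpace H]
    (B : NonUnitalStarSubalgebra ℂ (H →L[ℂ] H))
    (hBclosed : IsClosed (B : Set (H →L[ℂ] H)))
    (hBhered : ∀ a ∈ B, ∀ b : H →L[ℂ] H, b.IsPositive → (a - b).IsPositive → b ∈ B)
    (A : Set X → H →L[ℂ] H) (μ : H → Measure X)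
    (hempty : A ∅ = 0)
    (hpos : ∀ Δ : Set X, MeasurableSet Δ → (A Δ).IsPositive)
    (hfin : ∀ φ : H, IsFiniteMeasure (μ φ))
    (hcompat : ∀ (φ : H) (Δ : Set X), MeasurableSet Δ →
      ((μ φ Δ).toReal : ℂ) = ⟪φ, A Δ φ⟫)
    (hloc : ∀ U : Set X, IsOpen U → IsCompact (closure U) → A U ∈ B)
    (f : C₀(X, ℂ)) (T : H →L[ℂ] H)
    (hT : ∀ φ : H, ⟪φ, T φ⟫ = ∫ x, f x ∂(μ φ)) :
    T ∈ B := by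
  have hA : ∀ K : Set X, IsCompact K → ∀ Δ ⊆ K, MeasurableSet Δ → A Δ ∈ B := by
    intro K hK Δ hΔ hm
    obtain ⟨U, hU, hKU, hUc⟩ := exists_isOpen_superset_and_isCompact_closure hK
    refine hBhered (A U) (hloc U hU hUc) _ (hpos Δ hm) ?_
    have hd : A U - A Δ = A (U \ Δ) := by
      refine ContinuousLinearMap.coe_injective ((ext_inner_map _ _).1 fun φ => ?_)
      haveI := hfin φ
      simp only [ContinuousLinearMap.coe_coe]
      rw [← inner_conj_symm, ← inner_conj_symm (A (U \ Δ) φ)]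
      congr 1
      rw [ContinuousLinearMap.sub_apply, inner_sub_right, ← hcompat φ _ hU.measurableSet,
        ← hcompat φ _ hm, ← hcompat φ _ (hU.measurableSet.diff hm), ← Complex.ofReal_sub]
      congr 1
      exact (measureReal_diff (hΔ.trans hKU) hm).symm
    rw [hd]
    exact hpos _ (hU.measurableSet.diff hm)
  rw [← SetLike.mem_coe, ← hBclosed.closure_eq, Metric.mem_closure_iff]
  intro δ hδ
  have hc0 : 0 ≤ ‖A Set.univ‖ := norm_nonneg _
  set ε := δ / (8 * (‖A Set.univ‖ + 1)) with hεdef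
  have hε : 0 < ε := by positivity
  obtain ⟨K, s, hK, hs0, hfs⟩ := exists_simple_approx f ε hε
  let S : H →L[ℂ] H := ∑ z ∈ s.range, z • A (s ⁻¹' {z})
  refine ⟨S, ?_, ?_⟩
  · refine sum_mem fun z _ => ?_
    by_cases hz : z = 0
    · rw [hz, zero_smul]; exact zero_mem _
    · refine SMulMemClass.smul_mem z (hA K hK _ (fun x hx => ?_) (s.measurableSet_preimage _))
      by_contra hxK
      exact hz (by rw [← hs0 x hxK]; exact hx.symm)
  · have hq : ∀ φ : H, ‖⟪φ, (T - S) φ⟫‖ ≤ (ε * ‖A Set.univ‖) * ‖φ‖ ^ 2 := by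
      intro φ
      haveI := hfin φ
      have hsi : Integrable s (μ φ) := SimpleFunc.integrable_of_isFiniteMeasure s
      have hS : ⟪φ, S φ⟫ = ∫ x, s x ∂(μ φ) := by
        rw [← SimpleFunc.integral_eq_integral _ hsi, SimpleFunc.integral_eq]
        simp only [S, ContinuousLinearMap.sum_apply, inner_sum]
        refine Finset.sum_congr rfl fun z _ => ?_
        rw [ContinuousLinearMap.smul_apply, inner_smul_right,
          ← hcompat φ _ (s.measurableSet_preimage _), Complex.real_smul, mul_comm]
        rfl
      have hfi : Integrable f (μ φ) := by
        refine Integrable.of_bound (map_continuous f).measurable.aestronglyMeasurable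
          ‖f.toBCF‖ (Filter.Eventually.of_forall fun x => f.toBCF.norm_coe_le_norm x)
      rw [ContinuousLinearMap.sub_apply, inner_sub_right, hT, hS, ← integral_sub hfi hsi]
      refine (norm_integral_le_of_norm_le_const (Filter.Eventually.of_forall hfs)).trans ?_
      have hu : (μ φ).real Set.univ ≤ ‖A Set.univ‖ * ‖φ‖ ^ 2 := by
        have h1 := congrArg norm (hcompat φ Set.univ MeasurableSet.univ)
        rw [Complex.norm_real, Real.norm_of_nonneg ENNReal.toReal_nonneg] at h1
        rw [Measure.real, h1]
        refine (norm_inner_le_norm _ _).trans ?_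
        have := (A Set.univ).le_opNorm φ
        nlinarith [norm_nonneg φ]
      rw [mul_assoc]
      gcongr
    have := opNorm_le_of_quadratic (T - S) _ (by positivity) hq
    rw [dist_eq_norm]
    refine this.trans_lt ?_
    have he : ε * (8 * (‖A Set.univ‖ + 1)) = δ := by
      rw [hεdef]; field_simp
    nlinarith
end
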